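/- arXiv:1201.4572 — 10 statements merged into one kernel-verified Lean document; each statement's English description precedes it below -/
import Mathlib

section
/- Let n ≥ 1 and k ≥ 1 be integers and let λ = (λ_1 ≥ λ_2 ≥ … ≥ λ_n ≥ 0) be a partition with at most n parts. If the coefficient c_λ = ⟨a_{δ_n}^{2k}, s_λ⟩ (i.e. the coefficient of the monomial x_1^{λ_1+n−1} x_2^{λ_2+n−2} ⋯ x_n^{λ_n} in a_{δ_n}^{2k+1}) is nonzero, then |λ| = k·n·(n−1), the number of nonzero parts of λ is n−1 or n, k(n−1) ≤ λ_1 ≤ 2k(n−1), and λ_n ≤ k(n−1). -/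
open MvPolynomial Finset

/-- The Vandermonde determinant `a_{δ_n} = ∏_{1 ≤ i < j ≤ n} (x_i - x_j)`
as a multivariate polynomial over `ℤ` in variables indexed by `Fin n`. -/
noncomputable def vandermondePoly (n : ℕ) : MvPolynomial (Fin n) ℤ :=
  ∏ p ∈ Finset.univ.filter (fun p : Fin n × Fin n => p.1 < p.2), (X p.1 - X p.2)

/-- `⟨a_{δ_n}^{2k}, s_λ⟩`: the coefficient of the Schur function `s_λ` in the expansion
of `a_{δ_n}^{2k}`, i.e. the coefficient of the monomial
`x^{λ+δ_n} = x_1^{λ_1+n-1} x_2^{λ_2+n-2} ⋯ x_n^{λ_n}` in `a_{δ_n}^{2k+1}`.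
Here `lam i` is the part `λ_{i+1}` (0-indexed) and `δ_n` has `i`-th entry `n - 1 - i`. -/
noncomputable def schurCoeff (n k : ℕ) (lam : Fin n → ℕ) : ℤ :=
  MvPolynomial.coeff
    (Finsupp.equivFunOnFinite.symm fun i : Fin n => lam i + (n - 1 - (i : ℕ)))
    (vandermondePoly n ^ (2 * k + 1))

theorem two_mul_card_filter_fst_lt_snd (n : ℕ) :
    2 * #{p : Fin n × Fin n | p.1 < p.2} = n * (n - 1) := by
  have hswap : #{p : Fin n × Fin n | p.2 < p.1} = #{p : Fin n × Fin n | p.1 < p.2} :=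
    card_equiv (Equiv.prodComm _ _) (by simp)
  have hunion : ({p : Fin n × Fin n | p.1 < p.2} : Finset _) ∪
      ({p : Fin n × Fin n | p.2 < p.1} : Finset _) = offDiag univ := by
    ext p
    simp [lt_or_lt_iff_ne]
  have hdisj : Disjoint ({p : Fin n × Fin n | p.1 < p.2} : Finset _)
      ({p : Fin n × Fin n | p.2 < p.1} : Finset _) :=
    disjoint_filter.2 fun _ _ h => h.not_gt
  have hcard := card_union_of_disjoint hdisj
  rw [hunion, offDiag_card, hswap, card_fin] at hcard
  rw [two_mul, ← hcard, Nat.mul_sub, mul_one]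

theorem vandermondePoly_isHomogeneous (n : ℕ) :
    (vandermondePoly n).IsHomogeneous #{p : Fin n × Fin n | p.1 < p.2} := by
  rw [card_eq_sum_ones]
  exact IsHomogeneous.prod _ _ _ fun p _ =>
    (isHomogeneous_X ℤ p.1).sub (isHomogeneous_X ℤ p.2)

theorem degreeOf_vandermondePoly_le (n : ℕ) (i : Fin n) :
    degreeOf i (vandermondePoly n) ≤ n - 1 := by
  have hfactor (p : Fin n × Fin n) : degreeOf i (X p.1 - X p.2 : MvPolynomial (Fin n) ℤ) ≤
      if i = p.1 ∨ i = p.2 then 1 else 0 := by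
    refine (degreeOf_sub_le _ _ _).trans ?_
    rw [degreeOf_X, degreeOf_X]
    split_ifs <;> simp_all
  refine (degreeOf_prod_le _ _ _).trans ((sum_le_sum fun p _ => hfactor p).trans ?_)
  rw [← card_filter, filter_filter]
  have hcard : #(univ.erase i) = n - 1 := by simp
  rw [← hcard]
  refine card_le_card_of_injOn (fun p => if p.1 = i then p.2 else p.1) ?_ ?_
  · rintro ⟨a, b⟩ h
    simp only [coe_filter, mem_univ, true_and, Set.mem_ofPred_eq] at h
    simp only [coe_erase, coe_univ, Set.mem_sdiff, Set.mem_univ, Set.mem_singleton_iff, true_and]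
    grind
  · rintro ⟨a, b⟩ h ⟨c, d⟩ h' heq
    simp only [coe_filter, mem_univ, true_and, Set.mem_ofPred_eq] at h h' heq
    rw [Prod.mk.injEq]
    grind

theorem le_add_of_coeff_X_sub_X_pow_mul_ne_zero {σ R : Type*} [CommRing R] (i j : σ)
    (q : MvPolynomial σ R) (m : ℕ) (d : σ →₀ ℕ)
    (h : coeff d ((X i - X j) ^ m * q) ≠ 0) : m ≤ d i + d j := by
  classical
  induction m generalizing d with
  | zero => exact Nat.zero_le _
  | succ m ih =>
    rw [pow_succ', mul_assoc, sub_mul, coeff_sub, coeff_X_mul', coeff_X_mul'] at h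
    have hstep (l : σ) (hl : l = i ∨ l = j)
        (hne : (if l ∈ d.support then
          coeff (d - Finsupp.single l 1) ((X i - X j) ^ m * q) else 0) ≠ 0) :
        m + 1 ≤ d i + d j := by
      split_ifs at hne with hmem
      · have hle := ih _ hne
        have hpos : d l ≠ 0 := Finsupp.mem_support_iff.1 hmem
        simp only [Finsupp.tsub_apply, Finsupp.single_apply] at hle
        rcases hl with rfl | rfl
        · rw [if_pos rfl] at hle
          omega
        · rw [if_pos rfl] at hle
          omega
      · exact absurd rfl hne
    by_contra hlt
    refine h ?_
    rw [not_imp_comm.1 (hstep i (.inl rfl)) hlt, not_imp_comm.1 (hstep j (.inr rfl)) hlt, sub_zero]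

/-- basic properties of partitions with nonzero coefficient. -/
theorem stmt_0 (n k : ℕ) (hn : 1 ≤ n) (hk : 1 ≤ k)
    (lam : Fin n → ℕ) (hanti : Antitone lam)
    (hne : schurCoeff n k lam ≠ 0) :
    (∑ i, lam i) = k * n * (n - 1) ∧
    ((Finset.univ.filter fun i => lam i ≠ 0).card = n - 1 ∨
      (Finset.univ.filter fun i => lam i ≠ 0).card = n) ∧
    k * (n - 1) ≤ lam ⟨0, hn⟩ ∧
    lam ⟨0, hn⟩ ≤ 2 * k * (n - 1) ∧
    lam ⟨n - 1, by omega⟩ ≤ k * (n - 1) := by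
  have hsum_delta : 2 * ∑ i : Fin n, (n - 1 - (i : ℕ)) = n * (n - 1) := by
    rw [Fin.sum_univ_eq_sum_range (fun i => n - 1 - i), sum_range_reflect (fun i => i) n, mul_comm,
      sum_range_id_mul_two]
  have hdeg := (vandermondePoly_isHomogeneous n).pow (2 * k + 1) hne
  rw [Pi.one_def, ← Finsupp.degree_eq_weight_one, Finsupp.degree_eq_sum] at hdeg
  simp only [Finsupp.equivFunOnFinite_symm_apply_apply, sum_add_distrib] at hdeg
  have hpairs := two_mul_card_filter_fst_lt_snd n
  have hsum : ∑ i, lam i = k * n * (n - 1) := by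
    rw [mul_assoc]
    nlinarith
  have hfirst (i : Fin n) : lam i ≤ lam ⟨0, hn⟩ := hanti (Nat.zero_le _)
  have hlast (i : Fin n) : lam ⟨n - 1, by omega⟩ ≤ lam i := hanti (Nat.le_sub_one_of_lt i.2)
  refine ⟨hsum, ?_, ?_, ?_, ?_⟩
  · have hnonzero (i : Fin n) (hi : (i : ℕ) + 1 < n) : lam i ≠ 0 := by
      intro h0
      set a : Fin n := ⟨n - 2, by omega⟩ with ha
      set b : Fin n := ⟨n - 1, by omega⟩ with hb
      have ha0 : lam a = 0 := Nat.le_zero.1 (h0 ▸ hanti (show (i : ℕ) ≤ n - 2 by omega))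
      have hb0 : lam b = 0 := Nat.le_zero.1 (h0 ▸ hlast i)
      have hdvd : (X a - X b : MvPolynomial (Fin n) ℤ) ∣ vandermondePoly n :=
        dvd_prod_of_mem (fun p : Fin n × Fin n => (X p.1 - X p.2 : MvPolynomial (Fin n) ℤ))
          (a := (a, b)) (mem_filter.2 ⟨mem_univ _, show n - 2 < n - 1 by omega⟩)
      obtain ⟨q, hq⟩ := pow_dvd_pow_of_dvd hdvd (2 * k + 1)
      rw [schurCoeff, hq] at hne
      have hle := le_add_of_coeff_X_sub_X_pow_mul_ne_zero a b q _ _ hne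
      simp only [Finsupp.equivFunOnFinite_symm_apply_apply, ha0, hb0] at hle
      simp only [ha, hb] at hle
      omega
    have hsub : univ.erase ⟨n - 1, by omega⟩ ⊆ univ.filter fun i => lam i ≠ 0 := by
      intro i hi
      have hi' : (i : ℕ) ≠ n - 1 := fun h => (mem_erase.1 hi).1 (Fin.ext h)
      exact mem_filter.2 ⟨mem_univ _, hnonzero i (by omega)⟩
    have hlower := card_le_card hsub
    have hupper := card_le_univ (univ.filter fun i => lam i ≠ 0)
    rw [card_erase_of_mem (mem_univ _), card_fin] at hlower
    rw [Fintype.card_fin] at hupper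
    omega
  · have h := sum_le_card_nsmul univ lam _ fun i _ => hfirst i
    rw [hsum, card_fin, smul_eq_mul, mul_comm k n, mul_assoc] at h
    exact Nat.le_of_mul_le_mul_left h hn
  · have h := (le_degreeOf_of_mem_support ⟨0, hn⟩ (mem_support_iff.2 hne)).trans
      ((degreeOf_pow_le _ _ _).trans
        (Nat.mul_le_mul_left (2 * k + 1) (degreeOf_vandermondePoly_le n ⟨0, hn⟩)))
    simp only [Finsupp.equivFunOnFinite_symm_apply_apply, add_mul, one_mul] at h
    omega
  · have h := card_nsmul_le_sum univ lam _ fun i _ => hlast i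
    rw [hsum, card_fin, smul_eq_mul, mul_comm k n, mul_assoc] at h
    exact Nat.le_of_mul_le_mul_left h hn
end

section
/- Let n ≥ 1 and k ≥ 1 be integers, let λ = (λ_1 ≥ … ≥ λ_n ≥ 0) be a partition of k·n·(n−1) with at most n parts, and let μ = (2kn, λ_1, λ_2, …, λ_n) be the partition of k·n·(n+1) with n+1 parts obtained by adding a new top row of length 2kn. Then ⟨a_{δ_{n+1}}^{2k}, s_μ⟩ = ⟨a_{δ_n}^{2k}, s_λ⟩. -/
open MvPolynomial Finset

/-- Viewed as a polynomial in its first variable, the Vandermonde determinant in `n + 1` variables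
is a monic polynomial of degree `n` times the Vandermonde determinant in the other variables. -/
theorem finSuccEquiv_vandermondePoly (n : ℕ) :
    finSuccEquiv ℤ n (vandermondePoly (n + 1)) =
      (∏ i : Fin n, (Polynomial.X - Polynomial.C (X i))) * Polynomial.C (vandermondePoly n) := by
  simp [vandermondePoly, Finset.prod_filter, Fintype.prod_prod_type, Fin.prod_univ_succ,
    map_prod, apply_ite, finSuccEquiv_X_zero, finSuccEquiv_X_succ]

/-- The top coefficient, in the first variable, of a power of the Vandermonde determinant. -/
theorem coeff_finSuccEquiv_vandermondePoly_pow (n m : ℕ) :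
    (finSuccEquiv ℤ n (vandermondePoly (n + 1) ^ m)).coeff (m * n) = vandermondePoly n ^ m := by
  have hmonic : (∏ i : Fin n,
      (Polynomial.X - Polynomial.C (X i : MvPolynomial (Fin n) ℤ))).Monic :=
    Polynomial.monic_prod_X_sub_C _ _
  have hdeg : ((∏ i : Fin n,
      (Polynomial.X - Polynomial.C (X i : MvPolynomial (Fin n) ℤ))) ^ m).natDegree = m * n := by
    rw [hmonic.natDegree_pow, Polynomial.natDegree_finsetProd_X_sub_C_eq_card]
    simp
  rw [map_pow, finSuccEquiv_vandermondePoly, mul_pow, ← Polynomial.C_pow, Polynomial.coeff_mul_C,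
    ← hdeg, (hmonic.pow m).coeff_natDegree, one_mul]

/-- adding a top row of length `2kn` preserves the coefficient. -/
theorem stmt_3 (n k : ℕ) (hn : 1 ≤ n) (hk : 1 ≤ k)
    (lam : Fin n → ℕ) (hanti : Antitone lam)
    (hsum : ∑ i, lam i = k * n * (n - 1)) :
    schurCoeff (n + 1) k (Fin.cons (2 * k * n) lam) = schurCoeff n k lam := by
  unfold schurCoeff
  rw [← coeff_finSuccEquiv_vandermondePoly_pow n (2 * k + 1), finSuccEquiv_coeff_coeff]
  congr 1
  ext i
  refine Fin.cases ?_ (fun j => ?_) i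
  · simp
    ring
  · simp
    omega
end

section
/- Let n ≥ 1 and k ≥ 1 be integers, let λ = (λ_1 ≥ … ≥ λ_n ≥ 0) be a partition of k·n·(n−1) with at most n parts, and let μ = (λ_1+2k, λ_2+2k, …, λ_n+2k) be the partition of k·n·(n+1) obtained by adding 2k to every part. Then ⟨a_{δ_{n+1}}^{2k}, s_μ⟩ = ⟨a_{δ_n}^{2k}, s_λ⟩. -/
open MvPolynomial Finset

/-- Setting the last variable to zero keeps exactly the coefficients of the monomials
not involving that variable. -/
theorem coeff_aeval_snoc_zero {R : Type*} [CommRing R] {n : ℕ} (m : Fin n → ℕ)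
    (p : MvPolynomial (Fin (n + 1)) R) :
    coeff (Finsupp.equivFunOnFinite.symm m)
        (aeval (Fin.snoc (α := fun _ => MvPolynomial (Fin n) R) X 0) p) =
      coeff (Finsupp.equivFunOnFinite.symm (Fin.snoc (α := fun _ => ℕ) m 0)) p := by
  classical
  induction p using MvPolynomial.induction_on' with
  | add p q hp hq => simp only [map_add, coeff_add, hp, hq]
  | monomial u a =>
    rw [aeval_monomial, Finsupp.prod_fintype _ _ (fun _ => pow_zero _), Fin.prod_univ_castSucc,
      coeff_monomial]
    simp only [Fin.snoc_castSucc, Fin.snoc_last]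
    have hX : ∏ i : Fin n, (X i : MvPolynomial (Fin n) R) ^ u i.castSucc =
        monomial (Finsupp.equivFunOnFinite.symm fun i => u i.castSucc) 1 := by
      rw [monomial_eq, Finsupp.prod_fintype _ _ (fun _ => pow_zero _)]
      simp
    have hu : u = Finsupp.equivFunOnFinite.symm (Fin.snoc (α := fun _ => ℕ) m 0) ↔
        (Finsupp.equivFunOnFinite.symm fun i : Fin n => u i.castSucc) =
          Finsupp.equivFunOnFinite.symm m ∧ u (Fin.last n) = 0 := by
      simp [Finsupp.ext_iff, funext_iff, Fin.forall_fin_succ']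
    rw [hX, algebraMap_eq]
    by_cases h : u (Fin.last n) = 0
    · simp only [h, pow_zero, mul_one, coeff_C_mul, coeff_monomial, hu, and_true]
      simp
    · simp [h, hu]

theorem vandermondePoly_eq_prod_prod (n : ℕ) :
    vandermondePoly n = ∏ i, ∏ j, if i < j then X i - X j else 1 := by
  rw [vandermondePoly, Finset.prod_filter, ← Finset.univ_product_univ, Finset.prod_product]

theorem aeval_snoc_zero_vandermondePoly (n : ℕ) :
    aeval (Fin.snoc (α := fun _ => MvPolynomial (Fin n) ℤ) X 0) (vandermondePoly (n + 1)) =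
      (∏ i, X i) * vandermondePoly n := by
  simp only [vandermondePoly_eq_prod_prod, map_prod, apply_ite (aeval _), map_sub, aeval_X, map_one]
  simp only [Fin.prod_univ_castSucc, Fin.snoc_castSucc, Fin.snoc_last,
    Fin.castSucc_lt_castSucc_iff, Fin.castSucc_lt_last, if_true, sub_zero,
    Finset.prod_mul_distrib, lt_irrefl, if_false, mul_one, (Fin.castSucc_lt_last _).not_gt,
    Finset.prod_const_one]
  exact mul_comm _ _

theorem schurCoeff_snoc_zero (n k : ℕ) (lam : Fin n → ℕ) :
    schurCoeff (n + 1) k (Fin.snoc (fun i : Fin n => lam i + 2 * k) 0) =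
      schurCoeff n k lam := by
  have hexp : (fun i : Fin (n + 1) =>
      (Fin.snoc (fun i : Fin n => lam i + 2 * k) 0 : Fin (n + 1) → ℕ) i + (n + 1 - 1 - (i : ℕ))) =
      Fin.snoc (α := fun _ => ℕ) (fun i : Fin n => (2 * k + 1) + (lam i + (n - 1 - (i : ℕ)))) 0 := by
    funext i
    induction i using Fin.lastCases with
    | last => simp
    | cast i =>
      simp only [Fin.snoc_castSucc, Fin.val_castSucc]
      omega
  have hX : (∏ i : Fin n, (X i : MvPolynomial (Fin n) ℤ)) ^ (2 * k + 1) =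
      monomial (Finsupp.equivFunOnFinite.symm fun _ => 2 * k + 1) 1 := by
    rw [monomial_eq, Finsupp.prod_fintype _ _ (fun _ => pow_zero _)]
    simp [Finset.prod_pow]
  have hadd : (Finsupp.equivFunOnFinite.symm
      fun i : Fin n => (2 * k + 1) + (lam i + (n - 1 - (i : ℕ)))) =
      (Finsupp.equivFunOnFinite.symm fun _ => 2 * k + 1) +
        Finsupp.equivFunOnFinite.symm fun i : Fin n => lam i + (n - 1 - (i : ℕ)) := by
    ext i
    simp
  rw [schurCoeff, schurCoeff, hexp, ← coeff_aeval_snoc_zero, map_pow,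
    aeval_snoc_zero_vandermondePoly, mul_pow, hX, hadd, coeff_monomial_mul, one_mul]

/-- adding `2k` to every part (a left block of width `2k`)
preserves the coefficient when passing from `n` to `n+1` variables. -/
theorem stmt_5 (n k : ℕ) (hn : 1 ≤ n) (hk : 1 ≤ k)
    (lam : Fin n → ℕ) (hanti : Antitone lam)
    (hsum : ∑ i, lam i = k * n * (n - 1)) :
    schurCoeff (n + 1) k (Fin.snoc (fun i : Fin n => lam i + 2 * k) 0) =
      schurCoeff n k lam :=
  schurCoeff_snoc_zero n k lam
end

section
/- Let n ≥ 2 and let λ = (λ_1 ≥ … ≥ λ_n ≥ 0) be a partition of n(n−1) with at least n−1 nonzero parts (so λ has n−1 or n nonzero parts) such that ⟨a_{δ_n}^2, s_λ⟩ ≠ 0. If λ_n = λ_{n−1} = … = λ_{n−i} = s (that is, the bottom i+1 parts of λ all equal s), then i ≤ s. Equivalently, the number of parts of λ equal to s at the bottom of its Young diagram is at most s+1. -/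
open MvPolynomial Finset

/-- Every monomial of `p` has degree at least `d` in the variables indexed by `S`. -/
def OrderAtLeast {σ : Type*} (S : Finset σ) (d : ℕ) (p : MvPolynomial σ ℤ) : Prop :=
  ∀ e : σ →₀ ℕ, coeff e p ≠ 0 → d ≤ ∑ j ∈ S, e j

namespace OrderAtLeast

variable {σ : Type*} {S : Finset σ}

theorem zero (p : MvPolynomial σ ℤ) : OrderAtLeast S 0 p := fun _ _ => Nat.zero_le _

theorem mul {a b : ℕ} {p q : MvPolynomial σ ℤ} (hp : OrderAtLeast S a p)
    (hq : OrderAtLeast S b q) : OrderAtLeast S (a + b) (p * q) := by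
  classical
  intro e he
  rw [coeff_mul] at he
  obtain ⟨⟨u, v⟩, huv, hne⟩ := Finset.exists_ne_zero_of_sum_ne_zero he
  obtain rfl := HasAntidiagonal.mem_antidiagonal.mp huv
  simp only [Finsupp.add_apply, Finset.sum_add_distrib]
  exact add_le_add (hp u (left_ne_zero_of_mul hne)) (hq v (right_ne_zero_of_mul hne))

theorem pow {a : ℕ} {p : MvPolynomial σ ℤ} (hp : OrderAtLeast S a p) (k : ℕ) :
    OrderAtLeast S (k * a) (p ^ k) := by
  induction k with
  | zero => simpa only [Nat.zero_mul] using zero (p ^ 0)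
  | succ k ih =>
    rw [pow_succ, Nat.succ_mul]
    exact ih.mul hp

theorem prod {ι : Type*} (t : Finset ι) (d : ι → ℕ) (f : ι → MvPolynomial σ ℤ)
    (h : ∀ p ∈ t, OrderAtLeast S (d p) (f p)) :
    OrderAtLeast S (∑ p ∈ t, d p) (∏ p ∈ t, f p) := by
  classical
  induction t using Finset.induction_on with
  | empty => simpa using zero _
  | insert p t hp ih =>
    rw [Finset.sum_insert hp, Finset.prod_insert hp]
    exact (h p (Finset.mem_insert_self p t)).mul
      (ih fun q hq => h q (Finset.mem_insert_of_mem hq))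

theorem X_sub_X {a b : σ} (ha : a ∈ S) (hb : b ∈ S) :
    OrderAtLeast S 1 (X a - X b) := by
  classical
  intro e he
  rw [coeff_sub, coeff_X, coeff_X] at he
  have key : ∀ c ∈ S, Finsupp.single c 1 = e → 1 ≤ ∑ j ∈ S, e j := by
    rintro c hc rfl
    simpa using Finset.single_le_sum (f := fun j => Finsupp.single c 1 j)
      (fun _ _ => Nat.zero_le _) hc
  by_cases h₁ : Finsupp.single a 1 = e
  · exact key a ha h₁
  · by_cases h₂ : Finsupp.single b 1 = e
    · exact key b hb h₂
    · simp [h₁, h₂] at he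

end OrderAtLeast

/-- The Vandermonde determinant has order at least `∑_{a ≥ N} (n - 1 - a)` in the variables
with index at least `N`. -/
theorem orderAtLeast_vandermondePoly (n N : ℕ) :
    OrderAtLeast (Finset.univ.filter fun j : Fin n => N ≤ (j : ℕ))
      (∑ a ∈ Finset.univ.filter (fun j : Fin n => N ≤ (j : ℕ)), (n - 1 - (a : ℕ)))
      (vandermondePoly n) := by
  have hcount : ∑ a ∈ Finset.univ.filter (fun j : Fin n => N ≤ (j : ℕ)), (n - 1 - (a : ℕ)) =
      ∑ p ∈ Finset.univ.filter (fun p : Fin n × Fin n => p.1 < p.2),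
        if N ≤ (p.1 : ℕ) then 1 else 0 := by
    rw [Finset.sum_filter, Finset.sum_filter, Fintype.sum_prod_type]
    refine Finset.sum_congr rfl fun a _ => ?_
    rw [← Finset.sum_filter, Finset.filter_lt_eq_Ioi]
    split_ifs with h <;> simp [Fin.card_Ioi]
  rw [hcount]
  refine OrderAtLeast.prod _ _ _ fun p hp => ?_
  have hlt : (p.1 : ℕ) < p.2 := (Finset.mem_filter.mp hp).2
  split_ifs with h
  · exact OrderAtLeast.X_sub_X (by simpa using h) (by simpa using h.trans hlt.le)
  · exact OrderAtLeast.zero _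

theorem sum_bottom {n i : ℕ} (hi : i < n) (f : ℕ → ℕ) :
    ∑ a ∈ Finset.univ.filter (fun j : Fin n => n - 1 - i ≤ (j : ℕ)), f (n - 1 - (a : ℕ)) =
      ∑ k ∈ Finset.range (i + 1), f k := by
  rw [Finset.sum_filter,
    Fin.sum_univ_eq_sum_range (fun a => if n - 1 - i ≤ a then f (n - 1 - a) else 0) n,
    ← Finset.sum_range_reflect, ← Finset.sum_filter]
  refine Finset.sum_congr_of_eq_on_inter ?_ ?_ ?_ <;> simp only [Finset.mem_filter, Finset.mem_range]
  · intro a ha h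
    omega
  · intro a ha h
    omega
  · intro a ha _
    congr 1
    omega

/-- if the coefficient is nonzero and the bottom `i+1` parts all equal `s`,
then `i ≤ s`. -/
theorem stmt_6 (n : ℕ) (hn : 2 ≤ n)
    (lam : Fin n → ℕ) (hanti : Antitone lam)
    (hsum : ∑ j, lam j = n * (n - 1))
    (hlen : n - 1 ≤ (Finset.univ.filter fun j => lam j ≠ 0).card)
    (hne : schurCoeff n 1 lam ≠ 0)
    (i s : ℕ) (hi : i < n)
    (hbottom : ∀ j : Fin n, n - 1 - i ≤ (j : ℕ) → lam j = s) :
    i ≤ s := by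
  have h := (orderAtLeast_vandermondePoly n (n - 1 - i)).pow (2 * 1 + 1) _ hne
  have hexp : ∑ a ∈ Finset.univ.filter (fun j : Fin n => n - 1 - i ≤ (j : ℕ)),
      (lam a + (n - 1 - (a : ℕ))) =
      ∑ a ∈ Finset.univ.filter (fun j : Fin n => n - 1 - i ≤ (j : ℕ)),
        (s + (n - 1 - (a : ℕ))) :=
    Finset.sum_congr rfl fun a ha => by rw [hbottom a (Finset.mem_filter.mp ha).2]
  simp only [Finsupp.equivFunOnFinite_symm_apply_apply] at h
  rw [hexp, sum_bottom hi (fun k => s + k), sum_bottom hi (fun k => k), Finset.sum_add_distrib,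
    Finset.sum_const, Finset.card_range, smul_eq_mul] at h
  have hg := Finset.sum_range_id_mul_two (i + 1)
  rw [Nat.add_sub_cancel] at hg
  exact Nat.le_of_mul_le_mul_left (by omega : (i + 1) * i ≤ (i + 1) * s) (Nat.succ_pos i)
end

section
/- Let n ≥ 2, k ≥ 1 and let λ = (λ_1 ≥ … ≥ λ_n ≥ 0) be a partition of k·n·(n−1) with at least n−1 nonzero parts such that ⟨a_{δ_n}^{2k}, s_λ⟩ ≠ 0. If λ_n = λ_{n−1} = … = λ_{n−i} = s, then k·i ≤ s; that is, the number of parts equal to s at the bottom of the Young diagram of λ is at most ⌊s/k⌋ + 1. -/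
open MvPolynomial Finset

/-- Every monomial of a product has `B`-degree at least the sum of lower bounds for the factors. -/
theorem MvPolynomial.le_sum_of_coeff_mul_ne_zero {σ R : Type*} [CommSemiring R] {B : Finset σ}
    {a b : ℕ} {P Q : MvPolynomial σ R}
    (hP : ∀ d, coeff d P ≠ 0 → a ≤ ∑ j ∈ B, d j) (hQ : ∀ d, coeff d Q ≠ 0 → b ≤ ∑ j ∈ B, d j)
    (d : σ →₀ ℕ) (hd : coeff d (P * Q) ≠ 0) : a + b ≤ ∑ j ∈ B, d j := by
  classical
  rw [coeff_mul] at hd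
  obtain ⟨⟨u, v⟩, huv, h⟩ := exists_ne_zero_of_sum_ne_zero hd
  rw [HasAntidiagonal.mem_antidiagonal] at huv
  subst huv
  have hu := hP u (left_ne_zero_of_mul h)
  have hv := hQ v (right_ne_zero_of_mul h)
  simp only [Finsupp.add_apply, sum_add_distrib]
  lia

theorem MvPolynomial.le_sum_of_coeff_prod_ne_zero {σ R ι : Type*} [CommSemiring R] {B : Finset σ}
    (t : Finset ι) (a : ι → ℕ) (P : ι → MvPolynomial σ R)
    (hP : ∀ p ∈ t, ∀ d, coeff d (P p) ≠ 0 → a p ≤ ∑ j ∈ B, d j)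
    (d : σ →₀ ℕ) (hd : coeff d (∏ p ∈ t, P p) ≠ 0) : ∑ p ∈ t, a p ≤ ∑ j ∈ B, d j := by
  classical
  induction t using Finset.induction_on generalizing d with
  | empty => simp
  | insert p t hp ih =>
    rw [sum_insert hp]
    rw [prod_insert hp] at hd
    exact le_sum_of_coeff_mul_ne_zero (hP p (mem_insert_self p t))
      (ih fun q hq => hP q (mem_insert_of_mem hq)) d hd

theorem MvPolynomial.le_sum_of_coeff_X_sub_X_ne_zero {σ : Type*} [DecidableEq σ] {B : Finset σ}
    (x y : σ) (d : σ →₀ ℕ) (hd : coeff d (X x - X y : MvPolynomial σ ℤ) ≠ 0) :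
    (if x ∈ B ∧ y ∈ B then 1 else 0) ≤ ∑ j ∈ B, d j := by
  split_ifs with h
  · rw [coeff_sub, coeff_X, coeff_X] at hd
    by_cases hx : Finsupp.single x 1 = d
    · subst hx
      simp [Finsupp.single_apply, h.1]
    · by_cases hy : Finsupp.single y 1 = d
      · subst hy
        simp [Finsupp.single_apply, h.2]
      · simp [hx, hy] at hd
  · exact Nat.zero_le _

theorem sum_range_ite_le {n i : ℕ} (hi : i < n) (f : ℕ → ℕ) :
    ∑ t ∈ range n, (if t ≤ i then f t else 0) = ∑ t ∈ range (i + 1), f t := by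
  rw [← sum_filter]
  congr 1
  ext t
  simp only [mem_filter, mem_range]
  lia

theorem sum_filter_last {n i : ℕ} (hi : i < n) (f : ℕ → ℕ) :
    ∑ j ∈ univ.filter (fun j : Fin n => n - 1 - i ≤ (j : ℕ)), f (n - 1 - (j : ℕ)) =
      ∑ t ∈ range (i + 1), f t := by
  rw [sum_filter, Fin.sum_univ_eq_sum_range
    (fun j => if n - 1 - i ≤ j then f (n - 1 - j) else 0) n, ← sum_range_ite_le hi,
    ← sum_range_reflect (fun t => if t ≤ i then f t else 0)]
  refine sum_congr rfl fun j hj => ?_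
  rw [mem_range] at hj
  exact if_congr (by lia) rfl rfl

/-- The number of pairs `x < y` among the last `i + 1` elements of `Fin n`. -/
theorem sum_pairs_last {n i : ℕ} (hi : i < n) :
    ∑ p : Fin n × Fin n with p.1 < p.2,
      (if p.1 ∈ univ.filter (fun j : Fin n => n - 1 - i ≤ (j : ℕ)) ∧
        p.2 ∈ univ.filter (fun j : Fin n => n - 1 - i ≤ (j : ℕ)) then 1 else 0)
      = ∑ t ∈ range (i + 1), t := by
  rw [← sum_filter_last hi (fun t => t), sum_filter, sum_filter, Fintype.sum_prod_type]
  refine sum_congr rfl fun x _ => ?_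
  split_ifs with hx
  · rw [← Fin.card_Ioi, card_eq_sum_ones, ← filter_lt_eq_Ioi, sum_filter]
    refine sum_congr rfl fun y _ => ?_
    by_cases hxy : x < y
    · have hy : n - 1 - i ≤ (y : ℕ) := hx.trans (le_of_lt hxy)
      simp only [mem_filter_univ, hxy, hx, hy, and_self, if_true]
    · simp [hxy]
  · simp only [mem_filter_univ, hx, false_and, if_false, ite_self, sum_const_zero]

/-- general `k` version: if the coefficient is nonzero and the bottom
`i+1` parts all equal `s`, then `k·i ≤ s`. -/
theorem stmt_7 (n k : ℕ) (hn : 2 ≤ n) (hk : 1 ≤ k)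
    (lam : Fin n → ℕ) (hanti : Antitone lam)
    (hsum : ∑ j, lam j = k * n * (n - 1))
    (hlen : n - 1 ≤ (Finset.univ.filter fun j => lam j ≠ 0).card)
    (hne : schurCoeff n k lam ≠ 0)
    (i s : ℕ) (hi : i < n)
    (hbottom : ∀ j : Fin n, n - 1 - i ≤ (j : ℕ) → lam j = s) :
    k * i ≤ s := by
  set B : Finset (Fin n) := univ.filter fun j => n - 1 - i ≤ (j : ℕ)
  set T := ∑ t ∈ range (i + 1), t with hT
  have hvand : ∀ d, coeff d (vandermondePoly n) ≠ 0 → T ≤ ∑ j ∈ B, d j := fun d hd => by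
    rw [hT, ← sum_pairs_last hi]
    exact le_sum_of_coeff_prod_ne_zero _ _ _
      (fun p _ => le_sum_of_coeff_X_sub_X_ne_zero p.1 p.2) d hd
  rw [schurCoeff, ← card_range (2 * k + 1), ← prod_const] at hne
  have hle := le_sum_of_coeff_prod_ne_zero _ (fun _ => T) _ (fun _ _ => hvand) _ hne
  have hs : ∑ j ∈ B, lam j = (i + 1) * s := by
    refine (sum_congr rfl fun j hj => hbottom j (mem_filter.1 hj).2).trans ?_
    exact (sum_filter_last hi fun _ => s).trans (by simp)
  have hδ : ∑ j ∈ B, (n - 1 - (j : ℕ)) = T := sum_filter_last hi fun t => t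
  simp only [sum_const, card_range, smul_eq_mul, Finsupp.equivFunOnFinite_symm_apply_apply,
    sum_add_distrib, hs, hδ] at hle
  have hgauss : T * 2 = (i + 1) * i := sum_range_id_mul_two (i + 1)
  refine le_of_mul_le_mul_left (a := i + 1) ?_ i.succ_pos
  calc (i + 1) * (k * i) = k * (T * 2) := by rw [hgauss]; ring
    _ ≤ (i + 1) * s := by linarith
end

section
/- Let n ≥ 2 and let λ = (λ_1 ≥ … ≥ λ_n ≥ 0) be a partition of n(n−1) with at least n−1 nonzero parts such that ⟨a_{δ_n}^2, s_λ⟩ ≠ 0. For 1 ≤ m ≤ n: if λ_1 = λ_2 = … = λ_i = 2n−m−1 (the top i parts equal 2n−m−1), then i ≤ m. -/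
open MvPolynomial Finset

/-- Multiplying polynomials adds upper bounds on the degree in the variables from `S`. -/
theorem sum_exponents_le_of_mem_support_mul {σ R : Type*} [CommSemiring R] (S : Finset σ)
    {p q : MvPolynomial σ R} {a b : ℕ} (hp : ∀ d ∈ p.support, ∑ j ∈ S, d j ≤ a)
    (hq : ∀ d ∈ q.support, ∑ j ∈ S, d j ≤ b) :
    ∀ d ∈ (p * q).support, ∑ j ∈ S, d j ≤ a + b := by
  classical
  intro d hd
  obtain ⟨u, hu, v, hv, rfl⟩ := Finset.mem_add.mp (MvPolynomial.support_mul p q hd)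
  simpa [Finset.sum_add_distrib] using add_le_add (hp u hu) (hq v hv)

theorem sum_exponents_le_of_mem_support_one {σ R : Type*} [CommSemiring R] (S : Finset σ) :
    ∀ d ∈ (1 : MvPolynomial σ R).support, ∑ j ∈ S, d j ≤ 0 := by
  classical
  intro d hd
  rw [MvPolynomial.mem_support_iff, MvPolynomial.coeff_one] at hd
  obtain rfl : 0 = d := by_contra fun h => hd (if_neg h)
  simp

theorem sum_exponents_le_of_mem_support_prod {σ R ι : Type*} [CommSemiring R] (S : Finset σ)
    (T : Finset ι) (f : ι → MvPolynomial σ R) (b : ι → ℕ)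
    (h : ∀ t ∈ T, ∀ d ∈ (f t).support, ∑ j ∈ S, d j ≤ b t) :
    ∀ d ∈ (∏ t ∈ T, f t).support, ∑ j ∈ S, d j ≤ ∑ t ∈ T, b t := by
  classical
  induction T using Finset.induction_on with
  | empty => simpa using sum_exponents_le_of_mem_support_one (R := R) S
  | insert t T ht ih =>
    rw [Finset.prod_insert ht, Finset.sum_insert ht]
    exact sum_exponents_le_of_mem_support_mul S (h t (Finset.mem_insert_self t T))
      (ih fun s hs => h s (Finset.mem_insert_of_mem hs))

theorem sum_exponents_le_of_mem_support_vandermondePoly (n i : ℕ) :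
    ∀ d ∈ (vandermondePoly n).support,
      ∑ j ∈ Finset.univ.filter (fun j : Fin n => (j : ℕ) < i), d j ≤
        ∑ j ∈ Finset.univ.filter (fun j : Fin n => (j : ℕ) < i), (n - 1 - (j : ℕ)) := by
  have hcount : ∑ p ∈ Finset.univ.filter (fun p : Fin n × Fin n => p.1 < p.2),
      (if (p.1 : ℕ) < i then 1 else 0) =
        ∑ j ∈ Finset.univ.filter (fun j : Fin n => (j : ℕ) < i), (n - 1 - (j : ℕ)) := by
    rw [Finset.sum_filter, Fintype.sum_prod_type, Finset.sum_filter]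
    refine Finset.sum_congr rfl fun j _ => ?_
    split_ifs
    · rw [← Finset.sum_filter, Finset.sum_const, smul_eq_mul, mul_one, Finset.filter_lt_eq_Ioi,
        Fin.card_Ioi]
    · simp
  rw [← hcount]
  refine sum_exponents_le_of_mem_support_prod _ _ _ _ fun p hp d hd => ?_
  have hlt : (p.1 : ℕ) < p.2 := (Finset.mem_filter.mp hp).2
  have hd' := MvPolynomial.support_sub (Fin n) (X p.1) (X p.2) hd
  rw [MvPolynomial.support_X, MvPolynomial.support_X] at hd'
  rcases Finset.mem_union.mp hd' with h | h <;> rw [Finset.mem_singleton.mp h] <;>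
    simp [Finsupp.single_apply]
  split_ifs <;> omega

theorem two_mul_sum_staircase (n i : ℕ) (hi : i ≤ n) :
    2 * ∑ j ∈ Finset.univ.filter (fun j : Fin n => (j : ℕ) < i), (n - 1 - (j : ℕ)) =
      i * (2 * n - i - 1) := by
  have hrange : ∑ j ∈ Finset.univ.filter (fun j : Fin n => (j : ℕ) < i), (n - 1 - (j : ℕ)) =
      ∑ j ∈ Finset.range i, (n - 1 - j) := by
    rw [Finset.sum_filter, Fin.sum_univ_eq_sum_range (fun j => if j < i then n - 1 - j else 0) n,
      ← Finset.sum_filter]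
    congr 1
    ext j
    simp only [Finset.mem_filter, Finset.mem_range]
    omega
  rw [hrange]
  clear hrange
  induction i with
  | zero => simp
  | succ i ih =>
    rw [Finset.sum_range_succ, mul_add, ih (by omega)]
    obtain ⟨c, rfl⟩ := Nat.exists_eq_add_of_le hi
    rw [show 2 * (i + 1 + c) - i - 1 = i + 1 + 2 * c by omega,
      show 2 * (i + 1 + c) - (i + 1) - 1 = i + 2 * c by omega,
      show i + 1 + c - 1 - i = c by omega]
    ring

/-- if the coefficient is nonzero and the top `i` parts all equal
`2n - m - 1` (for some `1 ≤ m ≤ n`), then `i ≤ m`. -/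
theorem stmt_8 (n : ℕ) (hn : 2 ≤ n)
    (lam : Fin n → ℕ) (hanti : Antitone lam)
    (hsum : ∑ j, lam j = n * (n - 1))
    (hlen : n - 1 ≤ (Finset.univ.filter fun j => lam j ≠ 0).card)
    (hne : schurCoeff n 1 lam ≠ 0)
    (m : ℕ) (hm1 : 1 ≤ m) (hmn : m ≤ n)
    (i : ℕ) (hi : i ≤ n)
    (htop : ∀ j : Fin n, (j : ℕ) < i → lam j = 2 * n - m - 1) :
    i ≤ m := by
  rcases Nat.eq_zero_or_pos i with rfl | hpos
  · exact Nat.zero_le m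
  have hV := sum_exponents_le_of_mem_support_vandermondePoly n i
  have hV3 := sum_exponents_le_of_mem_support_mul _
    (sum_exponents_le_of_mem_support_mul _ hV hV) hV
  have hbound := hV3 _ (MvPolynomial.mem_support_iff.mpr
    (by simpa only [schurCoeff, mul_one, pow_succ, pow_zero, one_mul] using hne))
  simp only [Finsupp.equivFunOnFinite_symm_apply_apply, Finset.sum_add_distrib] at hbound
  have hconst : ∑ j ∈ Finset.univ.filter (fun j : Fin n => (j : ℕ) < i), lam j =
      i * (2 * n - m - 1) := by
    rw [Finset.sum_congr rfl fun j hj => htop j (Finset.mem_filter.mp hj).2, Finset.sum_const,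
      smul_eq_mul, Fin.card_filter_val_lt, min_eq_right hi]
  have hstair := two_mul_sum_staircase n i hi
  have hle : 2 * n - m - 1 ≤ 2 * n - i - 1 := Nat.le_of_mul_le_mul_left (by omega) hpos
  omega
end

section
/- Let 1 ≤ m ≤ n and let λ = (λ_1 ≥ … ≥ λ_n ≥ 0) be a partition of n(n−1) with at least n−1 nonzero parts such that λ_1 = λ_2 = … = λ_m = 2n−m−1. Then ⟨a_{δ_n}^2, s_λ⟩ = ⟨a_{δ_m}^2, s_{((m−1)^m)}⟩ · ⟨a_{δ_{n−m}}^2, s_{(λ_{m+1}, λ_{m+2}, …, λ_n)}⟩, where ((m−1)^m) is the partition with m parts all equal to m−1 and (λ_{m+1}, …, λ_n) is the partition formed by the remaining n−m parts of λ. -/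
open MvPolynomial Finset

/-- `p` and `q` have weighted degree at most `a` with respect to `w`, and their weighted
homogeneous components of degree `a` agree. -/
def TopEq {σ : Type*} (w : σ → ℕ) (a : ℕ) (p q : MvPolynomial σ ℤ) : Prop :=
  ∀ s : σ →₀ ℕ, (a ≤ Finsupp.weight w s → coeff s p = coeff s q) ∧
    (a < Finsupp.weight w s → coeff s p = 0)

namespace TopEq

variable {σ : Type*} {w : σ → ℕ}

theorem one : TopEq w 0 1 1 := by
  classical
  refine fun s => ⟨fun _ => rfl, fun h => ?_⟩
  rw [coeff_one, if_neg]
  rintro rfl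
  simp at h

theorem mul {a b : ℕ} {p q p' q' : MvPolynomial σ ℤ}
    (h : TopEq w a p q) (h' : TopEq w b p' q') : TopEq w (a + b) (p * p') (q * q') := by
  classical
  refine fun s => ⟨fun hs => ?_, fun hs => ?_⟩ <;> rw [coeff_mul]
  · rw [coeff_mul]
    refine Finset.sum_congr rfl fun x hx => ?_
    rw [← Finset.HasAntidiagonal.mem_antidiagonal.1 hx, map_add] at hs
    rcases lt_trichotomy a (Finsupp.weight w x.1) with hlt | heq | hgt
    · rw [← (h x.1).1 hlt.le, (h x.1).2 hlt, zero_mul, zero_mul]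
    · rw [(h x.1).1 heq.le, (h' x.2).1 (by lia)]
    · have hlt : b < Finsupp.weight w x.2 := by lia
      rw [← (h' x.2).1 hlt.le, (h' x.2).2 hlt, mul_zero, mul_zero]
  · refine Finset.sum_eq_zero fun x hx => ?_
    rw [← Finset.HasAntidiagonal.mem_antidiagonal.1 hx, map_add] at hs
    by_cases hlt : a < Finsupp.weight w x.1
    · rw [(h x.1).2 hlt, zero_mul]
    · rw [(h' x.2).2 (by lia), mul_zero]

theorem prod {ι : Type*} (t : Finset ι) {a : ι → ℕ} {p q : ι → MvPolynomial σ ℤ}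
    (h : ∀ i ∈ t, TopEq w (a i) (p i) (q i)) :
    TopEq w (∑ i ∈ t, a i) (∏ i ∈ t, p i) (∏ i ∈ t, q i) := by
  classical
  induction t using Finset.induction_on with
  | empty => simpa using one
  | insert i t hi ih =>
    rw [Finset.sum_insert hi, Finset.prod_insert hi, Finset.prod_insert hi]
    exact (h i (by simp)).mul (ih fun j hj => h j (by simp [hj]))

theorem pow {a : ℕ} {p q : MvPolynomial σ ℤ} (h : TopEq w a p q) (k : ℕ) :
    TopEq w (k * a) (p ^ k) (q ^ k) := by
  simpa using prod (Finset.range k) (fun _ _ => h)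

theorem X_sub_X {a : ℕ} {i j : σ} (hi : w i ≤ a) (hj : w j ≤ a) :
    TopEq w a (X i - X j) (X i - X j) := by
  classical
  refine fun s => ⟨fun _ => rfl, fun h => ?_⟩
  rw [coeff_sub, coeff_X, coeff_X, if_neg, if_neg, sub_zero] <;>
  · rintro rfl
    simp [Finsupp.weight_single] at h
    lia

theorem X_sub_X_left {a : ℕ} {i j : σ} (hi : w i ≤ a) (hj : w j < a) :
    TopEq w a (X i - X j) (X i) := by
  classical
  refine fun s => ⟨fun h => ?_, ((X_sub_X hi hj.le) s).2⟩
  rw [coeff_sub, coeff_X j, if_neg, sub_zero]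
  rintro rfl
  simp [Finsupp.weight_single] at h
  lia

end TopEq

theorem vandermondePoly_eq_prod (n : ℕ) :
    vandermondePoly n = ∏ i : Fin n, ∏ j : Fin n, if i < j then X i - X j else 1 := by
  rw [vandermondePoly, Finset.prod_filter, ← Finset.univ_product_univ, Finset.prod_product]

theorem rename_vandermondePoly {n : ℕ} {τ : Type*} (f : Fin n → τ) :
    rename f (vandermondePoly n) =
      ∏ i : Fin n, ∏ j : Fin n, if i < j then X (f i) - X (f j) else 1 := by
  simp only [vandermondePoly_eq_prod, map_prod, apply_ite (rename f), map_sub, rename_X, map_one]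

theorem vandermondePoly_add (m r : ℕ) :
    vandermondePoly (m + r) =
      rename (Fin.castAdd r) (vandermondePoly m) * rename (Fin.natAdd m) (vandermondePoly r) *
        ∏ i : Fin m, ∏ j : Fin r, (X (Fin.castAdd r i) - X (Fin.natAdd m j)) := by
  have h1 : ∀ (i : Fin m) (j : Fin r), Fin.castAdd r i < Fin.natAdd m j := fun i j => by
    simp only [Fin.lt_def, Fin.val_castAdd, Fin.val_natAdd]; lia
  have h2 : ∀ (i : Fin m) (j : Fin r), ¬ Fin.natAdd m j < Fin.castAdd r i :=
    fun i j => (h1 i j).not_gt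
  have h3 : ∀ i j : Fin m, Fin.castAdd r i < Fin.castAdd r j ↔ i < j := fun i j => by
    rw [Fin.lt_def, Fin.lt_def]; simp
  have h4 : ∀ i j : Fin r, Fin.natAdd m i < Fin.natAdd m j ↔ i < j := fun i j => by
    rw [Fin.lt_def, Fin.lt_def]; simp
  rw [vandermondePoly_eq_prod, rename_vandermondePoly, rename_vandermondePoly]
  simp only [Fin.prod_univ_add, h1, h2, h3, h4, if_true, if_false, Finset.prod_const_one,
    Finset.prod_mul_distrib]
  ring

theorem sum_sum_lt_eq (m : ℕ) :
    ∑ i : Fin m, ∑ j : Fin m, (if i < j then 1 else 0) = ∑ i : Fin m, (m - 1 - (i : ℕ)) := by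
  refine Finset.sum_congr rfl fun i _ => ?_
  rw [← Finset.card_filter, Finset.filter_lt_eq_Ioi, Fin.card_Ioi]

theorem sum_rev_mul_two (m : ℕ) : (∑ i : Fin m, (m - 1 - (i : ℕ))) * 2 = m * (m - 1) := by
  rw [Fin.sum_univ_eq_sum_range (fun i => m - 1 - i), Finset.sum_range_reflect (fun i => i),
    Finset.sum_range_id_mul_two]

/-- The part of the Vandermonde product of highest degree in the first `m` variables. -/
theorem topEq_vandermondePoly_add (m r : ℕ) :
    TopEq (Fin.append (fun _ : Fin m => 1) (fun _ : Fin r => 0))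
      (∑ i : Fin m, (m - 1 - (i : ℕ)) + m * r)
      (vandermondePoly (m + r))
      (rename (Fin.castAdd r) (vandermondePoly m * ∏ i : Fin m, X i ^ r) *
        rename (Fin.natAdd m) (vandermondePoly r)) := by
  have hA : TopEq (Fin.append (fun _ : Fin m => 1) (fun _ : Fin r => 0))
      (∑ i : Fin m, (m - 1 - (i : ℕ))) (rename (Fin.castAdd r) (vandermondePoly m))
      (rename (Fin.castAdd r) (vandermondePoly m)) := by
    rw [rename_vandermondePoly, ← sum_sum_lt_eq]
    refine .prod _ fun i _ => .prod _ fun j _ => ?_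
    split_ifs
    · exact .X_sub_X (by simp) (by simp)
    · exact .one
  have hB : TopEq (Fin.append (fun _ : Fin m => 1) (fun _ : Fin r => 0))
      0 (rename (Fin.natAdd m) (vandermondePoly r))
      (rename (Fin.natAdd m) (vandermondePoly r)) := by
    rw [rename_vandermondePoly]
    have h := TopEq.prod (w := Fin.append (fun _ : Fin m => 1) (fun _ : Fin r => 0))
      (Finset.univ : Finset (Fin r)) (a := fun _ => ∑ _j : Fin r, 0) fun i _ =>
        TopEq.prod (Finset.univ : Finset (Fin r))
          (p := fun j => if i < j then X (Fin.natAdd m i) - X (Fin.natAdd m j) else 1)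
          (q := fun j => if i < j then X (Fin.natAdd m i) - X (Fin.natAdd m j) else 1)
          fun j _ => by
            split_ifs
            · exact .X_sub_X (by simp) (by simp)
            · exact .one
    simpa using h
  have hC : TopEq (Fin.append (fun _ : Fin m => 1) (fun _ : Fin r => 0))
      (∑ _i : Fin m, ∑ _j : Fin r, 1)
      (∏ i : Fin m, ∏ j : Fin r, (X (Fin.castAdd r i) - X (Fin.natAdd m j)))
      (∏ i : Fin m, ∏ _j : Fin r, X (Fin.castAdd r i)) :=
    .prod _ fun i _ => .prod _ fun j _ => .X_sub_X_left (by simp) (by simp)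
  rw [vandermondePoly_add]
  convert (hA.mul hB).mul hC using 1
  · simp
  · simp only [map_mul, map_prod, map_pow, rename_X, Finset.prod_const, Finset.card_univ,
      Fintype.card_fin]
    ring

theorem coeff_rename_castAdd_mul_rename_natAdd {m r : ℕ} (p : MvPolynomial (Fin m) ℤ)
    (q : MvPolynomial (Fin r) ℤ) (u : Fin m → ℕ) (v : Fin r → ℕ) :
    coeff (Finsupp.equivFunOnFinite.symm (Fin.append u v))
        (rename (Fin.castAdd r) p * rename (Fin.natAdd m) q) =
      coeff (Finsupp.equivFunOnFinite.symm u) p * coeff (Finsupp.equivFunOnFinite.symm v) q := by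
  classical
  induction p using MvPolynomial.induction_on' with
  | add p p' hp hp' => simp only [map_add, add_mul, coeff_add, hp, hp']
  | monomial s a =>
    induction q using MvPolynomial.induction_on' with
    | add q q' hq hq' => simp only [map_add, mul_add, coeff_add, hq, hq']
    | monomial t b =>
      have hs : ∀ j, Finsupp.mapDomain (Fin.castAdd r) s (Fin.natAdd m j) = 0 := fun j =>
        Finsupp.mapDomain_of_notMem_range _ _ (by
          rintro ⟨i, hi⟩
          have := congrArg Fin.val hi
          simp only [Fin.val_castAdd, Fin.val_natAdd] at this
          lia)
      have ht : ∀ i, Finsupp.mapDomain (Fin.natAdd m) t (Fin.castAdd r i) = 0 := fun i =>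
        Finsupp.mapDomain_of_notMem_range _ _ (by
          rintro ⟨j, hj⟩
          have := congrArg Fin.val hj
          simp only [Fin.val_castAdd, Fin.val_natAdd] at this
          lia)
      have key : Finsupp.mapDomain (Fin.castAdd r) s + Finsupp.mapDomain (Fin.natAdd m) t =
          Finsupp.equivFunOnFinite.symm (Fin.append u v) ↔
          s = Finsupp.equivFunOnFinite.symm u ∧ t = Finsupp.equivFunOnFinite.symm v := by
        simp only [Finsupp.ext_iff, Fin.forall_fin_add, Finsupp.add_apply, hs, ht,
          Finsupp.mapDomain_apply (Fin.castAdd_injective m r),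
          Finsupp.mapDomain_apply (Fin.natAdd_injective r m),
          Finsupp.equivFunOnFinite_symm_apply_apply, Fin.append_left, Fin.append_right,
          add_zero, zero_add]
      rw [rename_monomial, rename_monomial, monomial_mul, coeff_monomial, coeff_monomial,
        coeff_monomial, ite_zero_mul_ite_zero]
      simp only [key]

theorem coeff_mul_prod_X_pow {m : ℕ} (p : MvPolynomial (Fin m) ℤ) (u : Fin m → ℕ) (k : ℕ) :
    coeff (Finsupp.equivFunOnFinite.symm fun i => u i + k) (p * ∏ i : Fin m, X i ^ k) =
      coeff (Finsupp.equivFunOnFinite.symm u) p := by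
  have h : (∏ i : Fin m, X i ^ k : MvPolynomial (Fin m) ℤ) =
      monomial (Finsupp.equivFunOnFinite.symm fun _ => k) 1 := by
    rw [monomial_eq, C_1, one_mul, Finsupp.prod_fintype _ _ (by simp)]
    simp
  have h' : (Finsupp.equivFunOnFinite.symm fun i => u i + k) =
      Finsupp.equivFunOnFinite.symm u + Finsupp.equivFunOnFinite.symm fun _ => k := by
    ext; simp
  rw [h, h', coeff_mul_monomial, mul_one]

/-- factorization of the coefficient when the top `m` parts equal
`2n - m - 1`. -/
theorem stmt_9 (n m : ℕ) (hm1 : 1 ≤ m) (hmn : m ≤ n)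
    (lam : Fin n → ℕ) (hanti : Antitone lam)
    (hsum : ∑ j, lam j = n * (n - 1))
    (hlen : n - 1 ≤ (Finset.univ.filter fun j => lam j ≠ 0).card)
    (htop : ∀ j : Fin n, (j : ℕ) < m → lam j = 2 * n - m - 1) :
    schurCoeff n 1 lam =
      schurCoeff m 1 (fun _ : Fin m => m - 1) *
        schurCoeff (n - m) 1
          (fun i : Fin (n - m) => lam ⟨m + (i : ℕ), by have := i.2; omega⟩) := by
  clear hanti hsum hlen
  obtain ⟨r, rfl⟩ := Nat.exists_eq_add_of_le hmn
  have hr : ∀ k (hk : k = r), schurCoeff k 1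
      (fun i : Fin k => lam ⟨m + (i : ℕ), by have := i.2; omega⟩) =
      schurCoeff r 1 fun i => lam (Fin.natAdd m i) := by
    rintro k rfl
    rfl
  rw [hr _ (Nat.add_sub_cancel_left m r)]
  have hexp : (fun i : Fin (m + r) => lam i + (m + r - 1 - (i : ℕ))) =
      Fin.append (fun i : Fin m => (m - 1 + (m - 1 - (i : ℕ))) + r * 3)
        (fun j : Fin r => lam (Fin.natAdd m j) + (r - 1 - (j : ℕ))) := by
    funext i
    induction i using Fin.addCases with
    | left i =>
      have := i.2
      rw [Fin.append_left, htop _ (by simp), Fin.val_castAdd]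
      lia
    | right j =>
      rw [Fin.append_right, Fin.val_natAdd]
      lia
  have hweight : Finsupp.weight (Fin.append (fun _ : Fin m => 1) (fun _ : Fin r => 0))
      (Finsupp.equivFunOnFinite.symm
        (Fin.append (fun i : Fin m => (m - 1 + (m - 1 - (i : ℕ))) + r * 3)
        (fun j : Fin r => lam (Fin.natAdd m j) + (r - 1 - (j : ℕ))))) =
      3 * (∑ i : Fin m, (m - 1 - (i : ℕ)) + m * r) := by
    have h2 := sum_rev_mul_two m
    rw [Finsupp.weight_apply, Finsupp.sum_fintype _ _ (by simp), Fin.sum_univ_add]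
    simp only [Finsupp.equivFunOnFinite_symm_apply_apply, Fin.append_left, Fin.append_right,
      smul_eq_mul, mul_one, mul_zero, Finset.sum_const_zero, add_zero, Finset.sum_add_distrib,
      Finset.sum_const, Finset.card_univ, Fintype.card_fin]
    linarith
  simp only [schurCoeff, mul_one, Nat.reduceAdd]
  rw [hexp, (((topEq_vandermondePoly_add m r).pow 3) _).1 hweight.ge, mul_pow, ← map_pow,
    ← map_pow, coeff_rename_castAdd_mul_rename_natAdd, mul_pow, ← Finset.prod_pow]
  simp only [← pow_mul]
  rw [coeff_mul_prod_X_pow]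
end

section
/- Let n ≥ 1 and 1 ≤ i ≤ n, and let λ be the partition with n−i parts equal to n+i−1 followed by i parts equal to i−1, i.e. λ = ((n+i−1)^{n−i}, (i−1)^i). Then ⟨a_{δ_n}^2, s_λ⟩ = (−1)^{(n−1)(n−2i)/2} · [1·3·5 ⋯ (2i−1)] · [1·3·5 ⋯ (2(n−i)−1)], where the empty product is 1. -/
open MvPolynomial Finset

/-- The product of the differences `v i - v j` over `i < j`. -/
def diffProd {R : Type*} [CommRing R] {n : ℕ} (v : Fin n → R) : R :=
  ∏ i, ∏ j ∈ Ioi i, (v i - v j)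

theorem vandermondePoly_eq_diffProd (n : ℕ) : vandermondePoly n = diffProd X := by
  rw [vandermondePoly, diffProd, prod_sigma']
  refine prod_bij' (fun p _ ↦ ⟨p.1, p.2⟩) (fun p _ ↦ (p.1, p.2)) ?_ ?_ ?_ ?_ ?_ <;> simp

theorem map_diffProd {R S F : Type*} [CommRing R] [CommRing S] [FunLike F R S] [RingHomClass F R S]
    (φ : F) {n : ℕ} (v : Fin n → R) : φ (diffProd v) = diffProd (fun i ↦ φ (v i)) := by
  simp [diffProd, map_prod]

theorem diffProd_comp_perm {R : Type*} [CommRing R] {n : ℕ} (v : Fin n → R)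
    (σ : Equiv.Perm (Fin n)) :
    diffProd (fun i ↦ v (σ i)) = (σ.sign : ℤ) * diffProd v :=
  σ.prod_Ioi_comp_eq_sign_mul_prod (f := fun i j ↦ v i - v j) fun i j ↦ by ring

theorem diffProd_add {R : Type*} [CommRing R] {m k : ℕ} (v : Fin (m + k) → R) :
    diffProd v = diffProd (fun i ↦ v (Fin.castAdd k i)) * diffProd (fun i ↦ v (Fin.natAdd m i)) *
      ∏ i, ∏ j, (v (Fin.castAdd k i) - v (Fin.natAdd m j)) := by
  have key {l : ℕ} (w : Fin l → R) :
      diffProd w = ∏ i, ∏ j, if i < j then w i - w j else 1 := by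
    simp only [diffProd, ← prod_filter, filter_lt_eq_Ioi]
  simp only [key, Fin.prod_univ_add, Fin.lt_def, Fin.val_castAdd,
    Fin.val_natAdd, prod_mul_distrib]
  have h (i : Fin k) (j : Fin m) : ¬ m + (i : ℕ) < j := by omega
  have h' (i : Fin m) (j : Fin k) : (i : ℕ) < m + j := by omega
  simp [h, h']
  ring

theorem diffProd_eq_sum_perm {R : Type*} [CommRing R] {n : ℕ} (v : Fin n → R) :
    diffProd v = (-1) ^ (n.choose 2) *
      ∑ σ : Equiv.Perm (Fin n), (σ.sign : ℤ) * ∏ i, v (σ i) ^ (i : ℕ) := by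
  have h : diffProd v = (Matrix.vandermonde fun i ↦ -v i).det := by
    rw [Matrix.det_vandermonde, diffProd]
    exact prod_congr rfl fun i _ ↦ prod_congr rfl fun j _ ↦ by ring
  rw [h, Matrix.det_apply', mul_sum]
  refine sum_congr rfl fun σ _ ↦ ?_
  have : ∏ i : Fin n, (-1 : R) ^ (i : ℕ) = (-1) ^ (n.choose 2) := by
    rw [prod_pow_eq_pow_sum, Fin.sum_univ_eq_sum_range (fun i ↦ i), sum_range_id,
      Nat.choose_two_right]
  simp only [Matrix.vandermonde_apply]
  rw [← this, mul_left_comm, ← prod_mul_distrib]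
  simp [← mul_pow]

theorem card_sigma_Ioi (n : ℕ) : #((univ : Finset (Fin n)).sigma fun i ↦ Ioi i) = n.choose 2 := by
  rw [card_sigma]
  simp only [Fin.card_Ioi]
  rw [Fin.sum_univ_eq_sum_range (fun i ↦ n - 1 - i), sum_range_reflect (fun i ↦ i), sum_range_id,
    Nat.choose_two_right]

theorem isHomogeneous_diffProd_X (R : Type*) [CommRing R] (n : ℕ) :
    (diffProd (X : Fin n → MvPolynomial (Fin n) R)).IsHomogeneous (n.choose 2) := by
  rw [diffProd, prod_sigma', ← card_sigma_Ioi, card_eq_sum_ones]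
  exact IsHomogeneous.prod _ _ _ fun p _ ↦ (isHomogeneous_X _ _).sub (isHomogeneous_X _ _)

/-- If `P` is homogeneous of the degree of `d`, only the constant term of `G` contributes to the
coefficient of `d` in `P * G`. -/
theorem coeff_mul_of_isHomogeneous {σ R : Type*} [CommRing R] {P : MvPolynomial σ R}
    {d : σ →₀ ℕ} (hP : P.IsHomogeneous d.degree) (G : MvPolynomial σ R) :
    coeff d (P * G) = coeff d P * constantCoeff G := by
  classical
  rw [coeff_mul, sum_eq_single (d, 0)]
  · rfl
  · rintro ⟨a, b⟩ hab hne
    rw [HasAntidiagonal.mem_antidiagonal] at hab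
    dsimp only at hab ⊢
    rw [hP.coeff_eq_zero, zero_mul]
    intro h
    have : b.degree = 0 := by
      rw [← hab, map_add] at h
      omega
    rw [Finsupp.degree_eq_zero_iff] at this
    subst this
    simp at hab
    exact hne (by rw [hab])
  · simp

theorem coeff_sumAlgEquiv {R σ τ : Type*} [CommSemiring R] (F : MvPolynomial (σ ⊕ τ) R)
    (d : σ ⊕ τ →₀ ℕ) :
    coeff (d.comapDomain Sum.inr Sum.inr_injective.injOn)
      (coeff (d.comapDomain Sum.inl Sum.inl_injective.injOn) (sumAlgEquiv R σ τ F)) = coeff d F := by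
  classical
  induction F using MvPolynomial.induction_on' with
  | monomial u r =>
    have h : sumAlgEquiv R σ τ (monomial u r) =
        monomial (u.comapDomain Sum.inl Sum.inl_injective.injOn)
          (monomial (u.comapDomain Sum.inr Sum.inr_injective.injOn) r) := by
      simp [sumAlgEquiv, monomial, Finsupp.sumFinsuppAddEquivProdFinsupp,
        Finsupp.sumFinsuppEquivProdFinsupp]
    have h' : u = d ↔ u.comapDomain Sum.inl Sum.inl_injective.injOn =
          d.comapDomain Sum.inl Sum.inl_injective.injOn ∧
        u.comapDomain Sum.inr Sum.inr_injective.injOn =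
          d.comapDomain Sum.inr Sum.inr_injective.injOn := by
      simp [DFunLike.ext_iff]
    rw [h]
    simp only [coeff_monomial, h']
    split_ifs <;> simp_all
  | add p q hp hq => simp only [map_add, coeff_add, hp, hq]

/-- The coefficient formula behind the combinatorial Nullstellensatz: a coefficient of maximal total
degree is a weighted sum of the values of the polynomial on a grid. -/
theorem MvPolynomial.coeff_eq_sum_piFinset {σ K : Type*} [Fintype σ] [DecidableEq σ] [Field K]
    [DecidableEq K] (F : MvPolynomial σ K) (d : σ →₀ ℕ) (S : σ → Finset K)
    (hS : ∀ i, #(S i) = d i + 1) (hF : F.totalDegree ≤ d.degree) :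
    coeff d F = ∑ p ∈ Fintype.piFinset S,
      eval p F / ∏ i, ∏ t ∈ (S i).erase (p i), (p i - t) := by
  have uni (i : σ) (e : ℕ) (he : e ≤ d i) :
      ∑ c ∈ S i, c ^ e / ∏ t ∈ (S i).erase c, (c - t) = if e = d i then 1 else 0 := by
    have := Lagrange.coeff_eq_sum (s := S i) (v := id) (Set.injOn_id _)
      (P := (Polynomial.X ^ e : Polynomial K))
      (by rw [Polynomial.degree_X_pow, hS]; exact_mod_cast Nat.lt_succ_of_le he)
    simp only [Polynomial.eval_pow, Polynomial.eval_X, id, hS, Nat.add_sub_cancel,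
      Polynomial.coeff_X_pow] at this
    rw [← this]
    simp only [eq_comm]
  simp_rw [eval_eq', sum_div]
  rw [sum_comm]
  have : ∀ e ∈ F.support, ∑ p ∈ Fintype.piFinset S,
      coeff e F * (∏ i, p i ^ e i) / ∏ i, ∏ t ∈ (S i).erase (p i), (p i - t) =
      if e = d then coeff e F else 0 := by
    intro e he
    simp_rw [mul_div_assoc, ← prod_div_distrib, ← mul_sum]
    rw [← prod_univ_sum S (fun i c ↦ c ^ e i / ∏ t ∈ (S i).erase c, (c - t))]
    split_ifs with h
    · subst h
      simp [uni]
    · obtain ⟨i, hi⟩ : ∃ i, e i < d i := by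
        by_contra! hle
        have h1 : e.degree ≤ d.degree := (le_totalDegree he).trans hF
        refine h (DFunLike.ext _ _ fun i ↦ ?_)
        rw [Finsupp.degree_eq_sum, Finsupp.degree_eq_sum] at h1
        exact ((sum_eq_sum_iff_of_le fun i _ ↦ hle i).1
          ((sum_le_sum fun i _ ↦ hle i).antisymm h1) i (mem_univ i)).symm
      rw [prod_eq_zero (mem_univ i), mul_zero]
      rw [uni i _ hi.le, if_neg hi.ne]
  rw [sum_congr rfl this, sum_ite_eq']
  split_ifs with h
  · rfl
  · simpa using h

theorem coeff_prod_add_C {σ ι R : Type*} [CommRing R] (s : Finset ι) (L : ι → MvPolynomial σ R)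
    (c : ι → R) (hL : ∀ i ∈ s, (L i).IsHomogeneous 1) (d : σ →₀ ℕ) (hd : d.degree = #s) :
    coeff d (∏ i ∈ s, (L i + C (c i))) = coeff d (∏ i ∈ s, L i) := by
  classical
  rw [prod_add, coeff_sum, sum_eq_single s]
  · simp
  · intro t ht hne
    rw [mem_powerset] at ht
    rw [← map_prod, mul_comm, coeff_C_mul,
      (IsHomogeneous.prod t L (fun _ ↦ 1) fun i hi ↦ hL i (ht hi)).coeff_eq_zero, mul_zero]
    rw [hd, sum_const, smul_eq_mul, mul_one]
    exact (card_lt_card (ht.ssubset_of_ne hne)).ne'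
  · simp

theorem totalDegree_prod_add_C_le {σ ι R : Type*} [CommRing R] (s : Finset ι)
    (L : ι → MvPolynomial σ R) (c : ι → R) (hL : ∀ i ∈ s, (L i).IsHomogeneous 1) :
    (∏ i ∈ s, (L i + C (c i))).totalDegree ≤ #s := by
  refine (totalDegree_finsetProd _ _).trans ?_
  rw [card_eq_sum_ones]
  refine sum_le_sum fun i hi ↦ (totalDegree_add _ _).trans ?_
  simpa using (hL i hi).totalDegree_le

theorem eq_two_mul_of_gaps {m : ℕ} {x : Fin m → ℕ} (hx : ∀ i, x i ≤ 2 * m - 2)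
    (h : ∀ i j, i < j → x i + 2 ≤ x j ∨ x j + 3 ≤ x i) (i : Fin m) : x i = 2 * i := by
  have gap (i j) (hij : i ≠ j) : x i + 2 ≤ x j ∨ x j + 2 ≤ x i := by
    rcases hij.lt_or_gt with hlt | hlt <;> have := h _ _ hlt <;> omega
  have hinj : Function.Injective fun i ↦ (⟨x i / 2, by have := hx i; have := i.pos; omega⟩ : Fin m) := by
    intro i j hij
    by_contra hne
    simp only [Fin.mk.injEq] at hij
    have := gap i j hne
    omega
  let s := (Equiv.ofBijective _ (Finite.injective_iff_bijective.1 hinj)).symm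
  have hs (k : Fin m) : x (s k) / 2 = k :=
    congrArg Fin.val
      ((Equiv.ofBijective _ (Finite.injective_iff_bijective.1 hinj)).apply_symm_apply k)
  have key : ∀ k, ∀ j : Fin m, (j : ℕ) + k + 1 = m → x (s j) = 2 * j ∧ s j ≤ j := by
    intro k
    induction k with
    | zero =>
      intro j hj
      have h1 := hx (s j)
      have h2 := hs j
      refine ⟨by omega, ?_⟩
      rw [Fin.le_def]
      omega
    | succ k ih =>
      intro j hj
      obtain ⟨h1, h2⟩ := ih ⟨j + 1, by omega⟩ (by simp only; omega)
      have hne : s j ≠ s ⟨j + 1, by omega⟩ := s.injective.ne (by simp [Fin.ext_iff])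
      have h3 := gap _ _ hne
      have h4 := hs j
      simp only at h1
      have h5 : x (s j) = 2 * j := by omega
      refine ⟨h5, ?_⟩
      rcases hne.lt_or_gt with hlt | hlt
      · rw [Fin.le_def] at h2 ⊢
        rw [Fin.lt_def] at hlt
        simp only at h2
        omega
      · have := h _ _ hlt
        omega
  have key' (j : Fin m) : x (s j) = 2 * j ∧ s j ≤ j := key (m - 1 - j) j (by omega)
  have hid : ∀ j ∈ univ, (s j : ℕ) = j :=
    (sum_eq_sum_iff_of_le fun j _ ↦ Fin.le_def.1 (key' j).2).1 (Equiv.sum_comp s fun j ↦ (j : ℕ))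
  have : s i = i := Fin.ext (hid i (mem_univ i))
  simpa only [this] using (key' i).1

theorem prod_erase_range_sub (a b : ℕ) :
    ∏ t ∈ (range (a + b + 1)).erase a, ((a : ℚ) - t) =
      (-1) ^ b * (a.factorial * b.factorial) := by
  induction b with
  | zero =>
    have : (range (a + 0 + 1)).erase a = range a := by ext; simp; omega
    rw [this]
    have : ∏ t ∈ range a, ((a : ℚ) - t) = ∏ t ∈ range a, ((t : ℚ) + 1) := by
      rw [← prod_range_reflect]
      refine prod_congr rfl fun t ht ↦ ?_
      have := mem_range.1 ht
      rw [Nat.sub_sub, Nat.cast_sub (by omega)]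
      push_cast
      ring
    rw [this]
    simp [← prod_range_add_one_eq_factorial, Nat.cast_prod]
  | succ b ih =>
    have : (range (a + (b + 1) + 1)).erase a = insert (a + b + 1) ((range (a + b + 1)).erase a) := by
      ext; simp; omega
    rw [this, prod_insert (by simp), ih, Nat.factorial_succ b]
    push_cast
    ring

theorem prod_Ioi_fin {M : Type*} [CommMonoid M] {m : ℕ} (i : Fin m) (f : ℕ → M) :
    ∏ j ∈ Ioi i, f j = ∏ t ∈ range (m - 1 - i), f (i + 1 + t) := by
  have : (Ioi i).map Fin.valEmbedding = Ico (i + 1 : ℕ) m := by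
    rw [Fin.map_valEmbedding_Ioi]
    ext
    simp
  rw [show ∏ j ∈ Ioi i, f j = ∏ j ∈ (Ioi i).map Fin.valEmbedding, f j by rw [prod_map]; rfl, this,
    prod_Ico_eq_prod_range, Nat.sub_add_eq, Nat.sub_right_comm]

theorem prod_range_four_consecutive (N : ℕ) :
    ∏ t ∈ range N, ∏ s ∈ range 4, (-2 * ((t : ℚ) + 1) + (1 - s)) =
      (2 * N + 2).factorial * (2 * N).factorial / 2 := by
  induction N with
  | zero => simp
  | succ N ih =>
    rw [prod_range_succ, ih, show 2 * (N + 1) + 2 = 2 * N + 2 + 1 + 1 by ring,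
      show 2 * (N + 1) = 2 * N + 1 + 1 by ring]
    simp only [Nat.factorial_succ, prod_range_succ, prod_range_zero]
    push_cast
    ring

theorem prod_factorial_ratio (m : ℕ) :
    ∏ i ∈ range m, (((2 * i + 2).factorial : ℚ) / (2 * (2 * i).factorial)) =
      m.factorial * ∏ t ∈ range m, (2 * (t : ℚ) + 1) := by
  rw [← prod_range_add_one_eq_factorial, Nat.cast_prod, ← prod_mul_distrib]
  refine prod_congr rfl fun i _ ↦ ?_
  have : ((2 * i).factorial : ℚ) ≠ 0 := by positivity
  simp only [Nat.factorial_succ]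
  field_simp
  push_cast
  ring

/-- The equal-parameter case `k = 2` of Dyson's constant term identity, over `ℚ`. The linear factors
are shifted so that exactly one point of the grid `{0, …, 2m - 2}ᵐ` contributes. -/
theorem coeff_diffProd_pow_four_rat (m : ℕ) :
    coeff (Finsupp.equivFunOnFinite.symm fun _ ↦ 2 * m - 2)
      (diffProd (X : Fin m → MvPolynomial (Fin m) ℚ) ^ 4) =
      m.factorial * ∏ t ∈ range m, (2 * (t : ℚ) + 1) := by
  set d : Fin m →₀ ℕ := Finsupp.equivFunOnFinite.symm fun _ ↦ 2 * m - 2 with hd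
  set T := ((univ : Finset (Fin m)).sigma fun i ↦ Ioi i) ×ˢ range 4 with hT
  have hdeg : d.degree = #T := by
    rw [hT, card_product, card_sigma_Ioi, card_range, Finsupp.degree_eq_sum]
    simp only [hd, Finsupp.coe_equivFunOnFinite_symm, sum_const, card_univ, Fintype.card_fin,
      smul_eq_mul]
    cases m with
    | zero => simp
    | succ m =>
      rw [Nat.choose_two_right, Nat.add_sub_cancel]
      have h2 := Nat.div_mul_cancel (Nat.even_mul_pred_self (m + 1)).two_dvd
      rw [Nat.add_sub_cancel] at h2
      rw [show 2 * (m + 1) - 2 = 2 * m by omega]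
      linarith
  have hL : ∀ q ∈ T, ((X q.1.1 - X q.1.2 : MvPolynomial (Fin m) ℚ)).IsHomogeneous 1 :=
    fun q _ ↦ (isHomogeneous_X _ _).sub (isHomogeneous_X _ _)
  have hpow : diffProd (X : Fin m → MvPolynomial (Fin m) ℚ) ^ 4 =
      ∏ q ∈ T, (X q.1.1 - X q.1.2) := by
    rw [hT, prod_product]
    simp only [prod_const, card_range]
    rw [prod_pow, prod_sigma, diffProd]
  rw [hpow, ← coeff_prod_add_C T _ (fun q ↦ 1 - (q.2 : ℚ)) hL d hdeg,
    MvPolynomial.coeff_eq_sum_piFinset _ d (fun _ ↦ (range (2 * m - 1)).map Nat.castEmbedding)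
      (fun i ↦ by simp [hd]; have := i.pos; omega)
      ((totalDegree_prod_add_C_le T _ _ hL).trans hdeg.ge),
    sum_eq_single fun i : Fin m ↦ (((2 * i : ℕ) : ℚ))]
  · simp only [map_prod, map_add, map_sub, eval_X, eval_C]
    rw [hT, prod_product, prod_sigma, ← prod_div_distrib, ← prod_factorial_ratio,
      ← Fin.prod_univ_eq_prod_range (fun i ↦ ((2 * i + 2).factorial : ℚ) / (2 * (2 * i).factorial)),
      prod_div_distrib, prod_div_distrib]
    have hnum (i : Fin m) : ∏ j ∈ Ioi i, ∏ s ∈ range 4,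
        (((2 * i : ℕ) : ℚ) - ((2 * j : ℕ) : ℚ) + (1 - s)) =
        (2 * (m - 1 - i) + 2).factorial * (2 * (m - 1 - i)).factorial / 2 := by
      rw [prod_Ioi_fin i fun j ↦ ∏ s ∈ range 4, (((2 * i : ℕ) : ℚ) - ((2 * j : ℕ) : ℚ) + (1 - s)),
        ← prod_range_four_consecutive]
      refine prod_congr rfl fun t _ ↦ prod_congr rfl fun s _ ↦ ?_
      push_cast
      ring
    have hden (i : Fin m) : ∏ t ∈ ((range (2 * m - 1)).map Nat.castEmbedding).erase
        ((2 * i : ℕ) : ℚ), (((2 * i : ℕ) : ℚ) - t) =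
        (2 * (i : ℕ)).factorial * (2 * (m - 1 - i)).factorial := by
      have h1 : ((range (2 * m - 1)).map Nat.castEmbedding).erase ((2 * i : ℕ) : ℚ) =
          ((range (2 * i + 2 * (m - 1 - i) + 1)).erase (2 * i)).map Nat.castEmbedding := by
        rw [map_erase, show 2 * (i : ℕ) + 2 * (m - 1 - i) + 1 = 2 * m - 1 by omega]
        rfl
      rw [h1, prod_map]
      refine (prod_erase_range_sub _ _).trans ?_
      simp
    have hrefl : ∏ i : Fin m, ((2 * (m - 1 - i) + 2).factorial : ℚ) =
        ∏ i : Fin m, ((2 * (i : ℕ) + 2).factorial : ℚ) := by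
      rw [Fin.prod_univ_eq_prod_range (fun i ↦ ((2 * (m - 1 - i) + 2).factorial : ℚ)),
        Fin.prod_univ_eq_prod_range (fun i ↦ ((2 * i + 2).factorial : ℚ)),
        prod_range_reflect (fun i ↦ ((2 * i + 2).factorial : ℚ))]
    rw [prod_congr rfl fun i _ ↦ hnum i, prod_congr rfl fun i _ ↦ hden i, ← hrefl,
      ← prod_div_distrib, ← prod_div_distrib]
    refine prod_congr rfl fun i _ ↦ ?_
    have h1 : ((2 * (i : ℕ)).factorial : ℚ) ≠ 0 := by positivity
    have h2 : ((2 * (m - 1 - i)).factorial : ℚ) ≠ 0 := by positivity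
    field_simp
  · intro p hp hne
    have hp' (i : Fin m) : ∃ x < 2 * m - 1, (x : ℚ) = p i := by
      simpa using Fintype.mem_piFinset.1 hp i
    choose x hx hxp using hp'
    rw [div_eq_zero_iff]
    left
    by_contra h0
    simp only [map_prod, map_add, map_sub, eval_X, eval_C, ← hxp] at h0
    rw [← ne_eq, prod_ne_zero_iff] at h0
    refine hne (funext fun i ↦ ?_)
    rw [← hxp, eq_two_mul_of_gaps (x := x) (fun i ↦ by have := hx i; omega) ?_ i]
    intro i j hij
    by_contra! hgap
    refine h0 (⟨i, j⟩, x i + 1 - x j) ?_ ?_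
    · simp [hT, hij]
      omega
    · simp only
      rw [Nat.cast_sub (by omega)]
      push_cast
      ring
  · intro h
    refine absurd (Fintype.mem_piFinset.2 fun i ↦ ?_) h
    simp only [mem_map, mem_range, Nat.castEmbedding_apply]
    exact ⟨2 * i, by omega, rfl⟩

theorem coeff_diffProd_pow_four (m : ℕ) :
    coeff (Finsupp.equivFunOnFinite.symm fun _ ↦ 2 * m - 2)
      (diffProd (X : Fin m → MvPolynomial (Fin m) ℤ) ^ 4) =
      m.factorial * ∏ t ∈ range m, (2 * (t : ℤ) + 1) := by
  have h := coeff_diffProd_pow_four_rat m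
  have h' : (diffProd (X : Fin m → MvPolynomial (Fin m) ℚ)) =
      map (Int.castRingHom ℚ) (diffProd X) := by
    simp [map_diffProd]
  rw [h', ← map_pow, coeff_map, eq_intCast] at h
  exact_mod_cast h

theorem coeff_perm_diffProd_cube {m : ℕ} (d : Fin m →₀ ℕ) (σ : Equiv.Perm (Fin m)) :
    coeff (d.mapDomain σ) (diffProd (X : Fin m → MvPolynomial (Fin m) ℤ) ^ 3) =
      (σ.sign : ℤ) * coeff d (diffProd (X : Fin m → MvPolynomial (Fin m) ℤ) ^ 3) := by
  rw [← coeff_rename_mapDomain σ σ.injective (diffProd X ^ 3) d, map_pow, map_diffProd]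
  simp only [rename_X]
  rw [diffProd_comp_perm, mul_pow]
  rcases Int.units_eq_one_or σ.sign with h | h <;> simp [h, Odd.neg_pow (by decide : Odd 3)]

theorem coeff_diffProd_cube (m : ℕ) :
    coeff (Finsupp.equivFunOnFinite.symm fun j : Fin m ↦ 2 * m - 2 - j)
      (diffProd (X : Fin m → MvPolynomial (Fin m) ℤ) ^ 3) =
      (-1) ^ (m.choose 2) * ∏ t ∈ range m, (2 * (t : ℤ) + 1) := by
  set P := diffProd (X : Fin m → MvPolynomial (Fin m) ℤ) with hP
  set d : Fin m →₀ ℕ := Finsupp.equivFunOnFinite.symm fun j : Fin m ↦ 2 * m - 2 - j with hd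
  have hterm (σ : Equiv.Perm (Fin m)) :
      coeff (Finsupp.equivFunOnFinite.symm fun _ ↦ 2 * m - 2)
        (P ^ 3 * ∏ i, X (σ i) ^ (i : ℕ)) = (σ.sign : ℤ) * coeff d (P ^ 3) := by
    have hmon : ∏ i, (X (σ i) : MvPolynomial (Fin m) ℤ) ^ (i : ℕ) =
        monomial (Finsupp.equivFunOnFinite.symm fun j ↦ (σ.symm j : ℕ)) 1 := by
      rw [monomial_eq, Finsupp.prod_fintype _ _ (by simp), map_one, one_mul]
      simpa using Equiv.prod_comp σ fun j ↦ (X j : MvPolynomial (Fin m) ℤ) ^ (σ.symm j : ℕ)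
    have hsum : (Finsupp.equivFunOnFinite.symm fun _ : Fin m ↦ 2 * m - 2) =
        d.mapDomain σ + Finsupp.equivFunOnFinite.symm fun j ↦ (σ.symm j : ℕ) := by
      ext j
      obtain ⟨k, rfl⟩ := σ.surjective j
      rw [Finsupp.add_apply, Finsupp.mapDomain_apply σ.injective]
      simp [hd]
      omega
    rw [hmon, hsum, coeff_mul_monomial, mul_one, coeff_perm_diffProd_cube]
  have h4 := coeff_diffProd_pow_four m
  rw [pow_succ, ← hP] at h4
  nth_rewrite 2 [hP] at h4
  rw [diffProd_eq_sum_perm, mul_left_comm, mul_sum, ← map_one C, ← map_neg, ← map_pow, coeff_C_mul,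
    coeff_sum] at h4
  have hsum : ∀ σ ∈ (univ : Finset (Equiv.Perm (Fin m))),
      coeff (Finsupp.equivFunOnFinite.symm fun _ ↦ 2 * m - 2)
        (P ^ 3 * (((σ.sign : ℤ) : MvPolynomial (Fin m) ℤ) * ∏ i, X (σ i) ^ (i : ℕ))) =
      coeff d (P ^ 3) := by
    intro σ _
    rw [mul_left_comm, ← eq_intCast (C : ℤ →+* MvPolynomial (Fin m) ℤ), coeff_C_mul, hterm,
      ← mul_assoc]
    rcases Int.units_eq_one_or σ.sign with h | h <;> simp [h]
  rw [sum_congr rfl hsum, sum_const, card_univ, Fintype.card_perm, Fintype.card_fin,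
    nsmul_eq_mul, mul_left_comm] at h4
  rw [← mul_left_cancel₀ (by positivity) h4, ← mul_assoc, ← mul_pow]
  simp

theorem coeff_diffProd_cube_add {m k : ℕ} (u : Fin m → ℕ) (v : Fin k → ℕ)
    (hv : ∑ j, v j = 3 * k.choose 2) :
    coeff (Finsupp.equivFunOnFinite.symm (Fin.addCases (fun a ↦ u a + 3 * k) v : Fin (m + k) → ℕ))
      (diffProd (X : Fin (m + k) → MvPolynomial (Fin (m + k)) ℤ) ^ 3) =
      coeff (Finsupp.equivFunOnFinite.symm u) (diffProd (X : Fin m → MvPolynomial (Fin m) ℤ) ^ 3) *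
      coeff (Finsupp.equivFunOnFinite.symm v)
        (diffProd (X : Fin k → MvPolynomial (Fin k) ℤ) ^ 3) := by
  let e : Fin (m + k) ≃ Fin k ⊕ Fin m := finSumFinEquiv.symm.trans (Equiv.sumComm _ _)
  have he1 (a : Fin m) : e (Fin.castAdd k a) = Sum.inr a := by simp [e]
  have he2 (a : Fin k) : e (Fin.natAdd m a) = Sum.inl a := by simp [e]
  set d : Fin (m + k) →₀ ℕ :=
    Finsupp.equivFunOnFinite.symm (Fin.addCases (fun a ↦ u a + 3 * k) v) with hd
  have hl : (d.mapDomain e).comapDomain Sum.inl Sum.inl_injective.injOn =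
      Finsupp.equivFunOnFinite.symm v := by
    ext a
    rw [Finsupp.comapDomain_apply, ← he2, Finsupp.mapDomain_apply e.injective]
    simp [hd]
  have hr : (d.mapDomain e).comapDomain Sum.inr Sum.inr_injective.injOn =
      Finsupp.equivFunOnFinite.symm u + Finsupp.equivFunOnFinite.symm fun _ ↦ 3 * k := by
    ext a
    rw [Finsupp.comapDomain_apply, ← he1, Finsupp.mapDomain_apply e.injective]
    simp [hd]
  have hB : (diffProd (X : Fin k → MvPolynomial (Fin k) (MvPolynomial (Fin m) ℤ)) ^ 3).IsHomogeneous
      (Finsupp.equivFunOnFinite.symm v).degree := by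
    have : (Finsupp.equivFunOnFinite.symm v).degree = k.choose 2 * 3 := by
      rw [Finsupp.degree_eq_sum, mul_comm, ← hv]
      rfl
    rw [this]
    exact (isHomogeneous_diffProd_X _ _).pow 3
  have hBcoeff : coeff (Finsupp.equivFunOnFinite.symm v)
      (diffProd (X : Fin k → MvPolynomial (Fin k) (MvPolynomial (Fin m) ℤ)) ^ 3) =
      C (coeff (Finsupp.equivFunOnFinite.symm v)
        (diffProd (X : Fin k → MvPolynomial (Fin k) ℤ) ^ 3)) := by
    rw [← coeff_map, map_pow, map_diffProd]
    simp
  have hmon : ∏ i : Fin m, ((X i : MvPolynomial (Fin m) ℤ) ^ k) ^ 3 =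
      monomial (Finsupp.equivFunOnFinite.symm fun _ ↦ 3 * k) 1 := by
    rw [monomial_eq, Finsupp.prod_fintype _ _ (by simp), map_one, one_mul]
    simp [← pow_mul, mul_comm]
  rw [← coeff_rename_mapDomain e e.injective, ← coeff_sumAlgEquiv, hl, hr, map_pow, map_pow,
    map_diffProd, map_diffProd, diffProd_add]
  simp only [rename_X, he1, he2, sumAlgEquiv_X_inl, sumAlgEquiv_X_inr]
  rw [← map_diffProd (C : MvPolynomial (Fin m) ℤ →+* MvPolynomial (Fin k) (MvPolynomial (Fin m) ℤ)),
    mul_pow, mul_pow, ← map_pow, mul_assoc, coeff_C_mul, coeff_mul_of_isHomogeneous hB, hBcoeff]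
  simp only [map_pow, map_prod, map_sub, constantCoeff_C, constantCoeff_X, sub_zero, prod_const,
    card_univ, Fintype.card_fin]
  rw [← prod_pow, hmon, mul_left_comm, coeff_C_mul, coeff_mul_monomial, mul_one, mul_comm]

/-- the coefficient of `s_{((n+i-1)^{n-i}, (i-1)^i)}`. -/
theorem stmt_11 (n i : ℕ) (hn : 1 ≤ n) (hi1 : 1 ≤ i) (hin : i ≤ n) :
    schurCoeff n 1
        (fun j : Fin n => if (j : ℕ) < n - i then n + i - 1 else i - 1) =
      (-1 : ℤ) ^ ((((n : ℤ) - 1) * ((n : ℤ) - 2 * (i : ℤ)) / 2).natAbs) *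
        (∏ t ∈ Finset.range i, (2 * (t : ℤ) + 1)) *
        (∏ t ∈ Finset.range (n - i), (2 * (t : ℤ) + 1)) := by
  obtain ⟨m, rfl⟩ := Nat.exists_eq_add_of_le' hin
  have hexp : (fun j : Fin (m + i) ↦ (if (j : ℕ) < m + i - i then m + i + i - 1 else i - 1) +
      (m + i - 1 - (j : ℕ))) =
      Fin.addCases (fun a : Fin m ↦ 2 * m - 2 - a + 3 * i) (fun b : Fin i ↦ 2 * i - 2 - b) := by
    ext j
    refine Fin.addCases (fun a ↦ ?_) (fun b ↦ ?_) j
    · rw [Fin.addCases_left, Fin.val_castAdd, if_pos (by omega)]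
      omega
    · rw [Fin.addCases_right, Fin.val_natAdd, if_neg (by omega)]
      omega
  have hsum : ∑ b : Fin i, (2 * i - 2 - (b : ℕ)) = 3 * i.choose 2 := by
    have h (b : Fin i) : 2 * i - 2 - (b : ℕ) = (i - 1) + (i - 1 - b) := by omega
    simp only [h, sum_add_distrib, sum_const, card_univ, Fintype.card_fin, smul_eq_mul]
    rw [Fin.sum_univ_eq_sum_range (fun b ↦ i - 1 - b), sum_range_reflect (fun b ↦ b), sum_range_id,
      Nat.choose_two_right]
    have := Nat.div_mul_cancel (Nat.even_mul_pred_self i).two_dvd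
    omega
  have hsign : (-1 : ℤ) ^ (((((m + i : ℕ) : ℤ) - 1) * (((m + i : ℕ) : ℤ) - 2 * (i : ℤ)) / 2).natAbs) =
      (-1) ^ (m.choose 2 + i.choose 2) := by
    have hchoose (l : ℕ) : (l : ℤ) * (l - 1) = 2 * (l.choose 2 : ℕ) := by
      have := Nat.div_mul_cancel (Nat.even_mul_pred_self l).two_dvd
      rw [← Nat.choose_two_right] at this
      cases l with
      | zero => simp
      | succ l =>
        rw [Nat.add_sub_cancel] at this
        zify at this
        push_cast
        linarith
    have h : (((m + i : ℕ) : ℤ) - 1) * (((m + i : ℕ) : ℤ) - 2 * (i : ℤ)) / 2 =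
        (m.choose 2 : ℕ) - (i.choose 2 : ℕ) := by
      apply Int.ediv_eq_of_eq_mul_right two_ne_zero
      push_cast
      linear_combination hchoose m - hchoose i
    rw [h]
    refine neg_one_pow_congr ?_
    rw [Int.natAbs_even, Int.even_sub, Int.even_coe_nat, Int.even_coe_nat, Nat.even_add]
  rw [schurCoeff, vandermondePoly_eq_diffProd, hexp, coeff_diffProd_cube_add _ _ hsum,
    coeff_diffProd_cube, coeff_diffProd_cube, hsign, Nat.add_sub_cancel, pow_add]
  ring
end

section
/- Let n ≥ 1, let λ = ((n−1)^n) be the partition of n(n−1) with n parts all equal to n−1, and let μ = (n+1, n^{n−1}, n−1) be the partition of n(n+1) with n+1 parts whose first part is n+1, followed by n−1 parts equal to n, followed by one part equal to n−1. Then ⟨a_{δ_{n+1}}^2, s_μ⟩ = (−1)^{n−1} · n · ⟨a_{δ_n}^2, s_λ⟩. -/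
open MvPolynomial Finset

section FunCoeff

variable {σ : Type*} [Finite σ]

/-- The coefficient of the monomial whose exponents are given by a function on a finite index
type. -/
noncomputable def funCoeff (f : σ → ℕ) : MvPolynomial σ ℤ →ₗ[ℤ] ℤ :=
  MvPolynomial.lcoeff ℤ (Finsupp.equivFunOnFinite.symm f)

theorem funCoeff_apply (f : σ → ℕ) (P : MvPolynomial σ ℤ) :
    funCoeff f P = coeff (Finsupp.equivFunOnFinite.symm f) P := rfl

theorem funCoeff_C_mul (f : σ → ℕ) (c : ℤ) (P : MvPolynomial σ ℤ) :
    funCoeff f (C c * P) = c * funCoeff f P :=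
  coeff_C_mul _ _ _

theorem funCoeff_X_mul [DecidableEq σ] (f : σ → ℕ) (i : σ) (P : MvPolynomial σ ℤ) :
    funCoeff f (X i * P) = if f i = 0 then 0 else funCoeff (f - Pi.single i 1) P := by
  rw [funCoeff_apply, coeff_X_mul']
  by_cases h : f i = 0
  · simp [h]
  · simp only [Finsupp.mem_support_iff, Finsupp.equivFunOnFinite_symm_apply_apply, ne_eq, h,
      not_false_eq_true, if_true, if_false, funCoeff_apply]
    congr 1
    ext j
    by_cases hj : i = j
    · subst hj; simp
    · simp [Ne.symm hj]

theorem funCoeff_monomial_mul [Fintype σ] (f g : σ → ℕ) (P : MvPolynomial σ ℤ) :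
    funCoeff (f + g) ((∏ i, X i ^ g i) * P) = funCoeff f P := by
  have h : (∏ i, X i ^ g i : MvPolynomial σ ℤ) =
      monomial (Finsupp.equivFunOnFinite.symm g) 1 := by
    rw [monomial_eq, Finsupp.prod_fintype _ _ (by simp)]
    simp
  have h2 : Finsupp.equivFunOnFinite.symm (f + g) =
      Finsupp.equivFunOnFinite.symm g + Finsupp.equivFunOnFinite.symm f := by
    ext j; simp [add_comm]
  rw [h, funCoeff_apply, h2, coeff_monomial_mul, one_mul, funCoeff_apply]

theorem funCoeff_rename (f : σ → ℕ) (e : Equiv.Perm σ) (P : MvPolynomial σ ℤ) :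
    funCoeff f (rename e P) = funCoeff (f ∘ e) P := by
  rw [funCoeff_apply, funCoeff_apply, ← coeff_rename_mapDomain e e.injective P]
  congr 1
  ext j
  obtain ⟨k, rfl⟩ := e.surjective j
  simp [Finsupp.mapDomain_apply e.injective]

theorem funCoeff_pderiv [DecidableEq σ] (f : σ → ℕ) (i : σ) (P : MvPolynomial σ ℤ) :
    funCoeff f (pderiv i P) = funCoeff (f + Pi.single i 1) P * (f i + 1) := by
  have h : Finsupp.equivFunOnFinite.symm (f + Pi.single i 1) =
      Finsupp.equivFunOnFinite.symm f + Finsupp.single i 1 := by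
    ext j; simp [Finsupp.single_apply, Pi.single_apply, eq_comm]
  rw [funCoeff_apply, funCoeff_apply, coeff_pderiv, h]
  simp

theorem funCoeff_eq_zero_of_mem_supported {i : σ} {P : MvPolynomial σ ℤ}
    (hP : P ∈ supported ℤ ({i}ᶜ : Set σ)) {f : σ → ℕ} (hf : f i ≠ 0) : funCoeff f P = 0 := by
  by_contra h
  have hi : i ∈ P.vars := by
    rw [mem_vars_iff_mem_support]
    exact ⟨_, mem_support_iff.2 h, by simpa using hf⟩
  simpa using (mem_supported.1 hP) hi

/-- `Q` has degree at most `d` in `x_i`, and its coefficient of `x_i ^ d` is `R`. -/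
def HasTopCoeff [DecidableEq σ] (i : σ) (d : ℕ) (Q R : MvPolynomial σ ℤ) : Prop :=
  (∀ f : σ → ℕ, d < f i → funCoeff f Q = 0) ∧
    ∀ f : σ → ℕ, f i = d → funCoeff f Q = funCoeff (Function.update f i 0) R

theorem HasTopCoeff.sub_mul [DecidableEq σ] {i j : σ} (hij : i ≠ j) {d : ℕ}
    {Q R : MvPolynomial σ ℤ} (h : HasTopCoeff i d Q R) :
    HasTopCoeff i (d + 1) ((X i - X j) * Q) R := by
  have key : ∀ f : σ → ℕ, d < f i → funCoeff f ((X i - X j) * Q) =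
      funCoeff (f - Pi.single i 1) Q := by
    intro f hf
    rw [_root_.sub_mul, map_sub, funCoeff_X_mul, funCoeff_X_mul, if_neg (by omega),
      h.1 (f - Pi.single j 1) (by simpa [hij] using hf)]
    simp
  refine ⟨fun f hf => ?_, fun f hf => ?_⟩
  · rw [key f (by omega)]
    exact h.1 _ (by simp; omega)
  · rw [key f (by omega), h.2 _ (by simp; omega)]
    congr 2
    ext k
    by_cases hk : k = i
    · subst hk; simp
    · simp [hk]

theorem HasTopCoeff.prod_mul [DecidableEq σ] {i : σ} {d : ℕ} {Q R : MvPolynomial σ ℤ}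
    (h : HasTopCoeff i d Q R) (T : Finset σ) (hT : i ∉ T) (a : σ → ℕ) :
    HasTopCoeff i (d + ∑ j ∈ T, a j) ((∏ j ∈ T, (X i - X j) ^ a j) * Q) R := by
  induction T using Finset.induction_on with
  | empty => simpa using h
  | insert j T hj ih =>
    have hij : i ≠ j := fun e => hT (by simp [e])
    rw [Finset.prod_insert hj, Finset.sum_insert hj]
    have ih := ih fun h => hT (Finset.mem_insert_of_mem h)
    generalize a j = m
    induction m with
    | zero => simpa using ih
    | succ m ihm =>
      have := ihm.sub_mul hij
      rw [pow_succ']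
      convert this using 1
      · ring
      · ring

theorem HasTopCoeff.of_mem_supported [DecidableEq σ] {i : σ} {P : MvPolynomial σ ℤ}
    (hP : P ∈ supported ℤ ({i}ᶜ : Set σ)) : HasTopCoeff i 0 P P := by
  refine ⟨fun f hf => funCoeff_eq_zero_of_mem_supported hP hf.ne', fun f hf => ?_⟩
  rw [← hf, Function.update_eq_self]

end FunCoeff

section Dyson

variable {σ : Type*} [DecidableEq σ]

/-- The homogeneous form `∏_{i ≠ j} (x_j - x_i) ^ a_i` of Dyson's product, over indices in `S`. -/
noncomputable def dysonProd (S : Finset σ) (a : σ → ℕ) : MvPolynomial σ ℤ :=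
  ∏ i ∈ S, (∏ j ∈ S.erase i, (X j - X i)) ^ a i

theorem dysonProd_mem_supported (S : Finset σ) (a : σ → ℕ) {i : σ} (hi : i ∉ S) :
    dysonProd S a ∈ supported ℤ ({i}ᶜ : Set σ) := by
  have hX : ∀ j ∈ S, (X j : MvPolynomial σ ℤ) ∈ supported ℤ ({i}ᶜ : Set σ) := fun j hj =>
    X_mem_supported.2 (by rintro rfl; exact hi hj)
  exact prod_mem fun j hj => pow_mem (prod_mem fun k hk =>
    sub_mem (hX k (Finset.mem_of_mem_erase hk)) (hX j hj)) _

theorem dysonProd_insert (T : Finset σ) (a : σ → ℕ) {i : σ} (hi : i ∉ T) :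
    dysonProd (insert i T) a = (∏ j ∈ T, (X j - X i)) ^ a i *
      ((∏ j ∈ T, (X i - X j) ^ a j) * dysonProd T a) := by
  rw [dysonProd, Finset.prod_insert hi, Finset.erase_insert hi, dysonProd,
    ← Finset.prod_mul_distrib]
  congr 1
  refine Finset.prod_congr rfl fun j hj => ?_
  have hij : i ≠ j := by rintro rfl; exact hi hj
  rw [Finset.erase_insert_of_ne hij, Finset.prod_insert (by simp [hi]), mul_pow]

theorem dysonProd_eq_mul_update (S : Finset σ) (a : σ → ℕ) {i : σ} (hi : i ∈ S) (ha : a i ≠ 0) :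
    dysonProd S a = (∏ j ∈ S.erase i, (X j - X i)) *
      dysonProd S (Function.update a i (a i - 1)) := by
  rw [dysonProd, dysonProd, ← Finset.mul_prod_erase _ _ hi, ← Finset.mul_prod_erase _ _ hi,
    ← mul_assoc, Function.update_self, mul_pow_sub_one ha]
  congr 1
  refine Finset.prod_congr rfl fun j hj => ?_
  rw [Function.update_of_ne (Finset.ne_of_mem_erase hj)]

/-- Lagrange interpolation of the constant `1`, evaluated at `0`. -/
theorem sum_prod_div_sub_eq_one {K : Type*} [Field K] (S : Finset σ) (hS : S.Nonempty) (v : σ → K)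
    (hv : Set.InjOn v S) : ∑ i ∈ S, ∏ j ∈ S.erase i, v j / (v j - v i) = 1 := by
  have h := congrArg (Polynomial.eval 0) (Lagrange.sum_basis hv hS)
  rw [Polynomial.eval_finsetSum, Polynomial.eval_one] at h
  rw [← h]
  refine Finset.sum_congr rfl fun i _ => ?_
  rw [Lagrange.basis, Polynomial.eval_prod]
  refine Finset.prod_congr rfl fun j _ => ?_
  simp only [Lagrange.basisDivisor, Polynomial.eval_mul, Polynomial.eval_C, Polynomial.eval_sub,
    Polynomial.eval_X]
  rw [← neg_sub (v j) (v i), inv_neg, div_eq_mul_inv]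
  ring

/-- Good's recursion for Dyson's product. -/
theorem dysonProd_eq_sum (S : Finset σ) (hS : S.Nonempty) (a : σ → ℕ) (ha : ∀ i ∈ S, a i ≠ 0) :
    dysonProd S a = ∑ i ∈ S, (∏ j ∈ S.erase i, X j) *
      dysonProd S (Function.update a i (a i - 1)) := by
  let φ := algebraMap (MvPolynomial σ ℤ) (FractionRing (MvPolynomial σ ℤ))
  have hφ : Function.Injective φ := IsFractionRing.injective _ _
  have hv : Set.InjOn (fun i => φ (X i)) S := fun i _ j _ h => X_injective (hφ h)
  apply hφ
  rw [map_sum, ← one_mul (φ (dysonProd S a)), ← sum_prod_div_sub_eq_one S hS _ hv, Finset.sum_mul]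
  refine Finset.sum_congr rfl fun i hi => ?_
  rw [dysonProd_eq_mul_update S a hi (ha i hi), Finset.prod_div_distrib, map_mul, map_mul,
    map_prod, map_prod]
  simp only [map_sub]
  rw [← mul_assoc, div_mul_cancel₀]
  refine Finset.prod_ne_zero_iff.2 fun j hj h => Finset.ne_of_mem_erase hj ?_
  exact hv (Finset.mem_of_mem_erase hj) hi (sub_eq_zero.1 h)

theorem sum_eq_sum_update_pred_add_one {S : Finset σ} {i : σ} (a : σ → ℕ) (hi : i ∈ S)
    (ha : a i ≠ 0) : ∑ k ∈ S, a k = ∑ k ∈ S, Function.update a i (a i - 1) k + 1 := by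
  rw [Finset.sum_update_of_mem hi, Finset.sdiff_singleton_eq_erase,
    ← Finset.add_sum_erase _ _ hi]
  omega

open Nat in
/-- Dyson's constant term identity. -/
theorem funCoeff_dysonProd [Fintype σ] (S : Finset σ) (a : σ → ℕ) :
    funCoeff (fun j => if j ∈ S then ∑ i ∈ S.erase j, a i else 0) (dysonProd S a) *
      ∏ i ∈ S, ((a i)! : ℤ) = ((∑ i ∈ S, a i)! : ℕ) := by
  induction hk : #S + ∑ i ∈ S, a i using Nat.strong_induction_on generalizing S a with
  | _ k ih =>
  subst hk
  by_cases h0 : ∃ i ∈ S, a i = 0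
  · obtain ⟨i, hi, hai⟩ := h0
    obtain ⟨T, hT, rfl⟩ : ∃ T, i ∉ T ∧ insert i T = S :=
      ⟨S.erase i, Finset.notMem_erase _ _, Finset.insert_erase hi⟩
    have := ih (#T + ∑ i ∈ T, a i) (by
      rw [Finset.card_insert_of_notMem hT, Finset.sum_insert hT]; omega) T a rfl
    rw [Finset.sum_insert hT, Finset.prod_insert hT, hai, zero_add, ← this, Nat.factorial_zero,
      Nat.cast_one, one_mul, dysonProd_insert T a hT, hai, pow_zero, one_mul]
    have hd := ((HasTopCoeff.of_mem_supported (dysonProd_mem_supported T a hT)).prod_mul T hT a).2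
    rw [hd _ (by simp [hT])]
    congr 3
    ext j
    by_cases hj : j = i
    · subst hj; simp [hT]
    · rw [Function.update_of_ne hj]
      by_cases hjT : j ∈ T
      · simp [hjT, Finset.erase_insert_of_ne (Ne.symm hj), hT, hai]
      · simp [hjT, hj]
  push Not at h0
  rcases S.eq_empty_or_nonempty with rfl | hS
  · simp [dysonProd, funCoeff_apply, coeff_one, Finsupp.ext_iff]
  rw [dysonProd_eq_sum S hS a h0, map_sum, Finset.sum_mul]
  have hsum : ∀ i ∈ S, ∑ k ∈ S, a k = ∑ k ∈ S, Function.update a i (a i - 1) k + 1 :=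
    fun i hi => sum_eq_sum_update_pred_add_one a hi (h0 i hi)
  have hterm : ∀ i ∈ S, funCoeff (fun j => if j ∈ S then ∑ i ∈ S.erase j, a i else 0)
      ((∏ j ∈ S.erase i, X j) * dysonProd S (Function.update a i (a i - 1))) *
      ∏ i ∈ S, ((a i)! : ℤ) = a i * ((∑ i ∈ S, a i - 1)! : ℕ) := by
    intro i hi
    have hI := ih _ (by have := hsum i hi; omega) S (Function.update a i (a i - 1)) rfl
    have hs : ∑ k ∈ S, Function.update a i (a i - 1) k = ∑ i ∈ S, a i - 1 := by
      have := hsum i hi; omega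
    rw [hs] at hI
    have hX : (∏ j ∈ S.erase i, X j : MvPolynomial σ ℤ) =
        ∏ j, X j ^ (if j ∈ S.erase i then 1 else 0) := by
      simp only [pow_ite, pow_one, pow_zero, Finset.prod_ite_mem, Finset.univ_inter]
    have hf : (fun j => if j ∈ S then ∑ i ∈ S.erase j, a i else 0) =
        (fun j => if j ∈ S then ∑ k ∈ S.erase j, Function.update a i (a i - 1) k else 0) +
          fun j => if j ∈ S.erase i then 1 else 0 := by
      ext j
      by_cases hj : j ∈ S
      · by_cases hji : j = i
        · subst hji
          simp only [hj, if_true, Pi.add_apply, Finset.notMem_erase, if_false, add_zero]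
          exact Finset.sum_congr rfl fun k hk => by
            rw [Function.update_of_ne (Finset.ne_of_mem_erase hk)]
        · simp only [hj, if_true, Pi.add_apply, Finset.mem_erase, hji, ne_eq, not_false_eq_true,
            and_self]
          exact sum_eq_sum_update_pred_add_one a (by simp [hi, Ne.symm hji]) (h0 i hi)
      · simp [hj]
    rw [hX, hf, funCoeff_monomial_mul, ← hI, ← Finset.mul_prod_erase _ _ hi,
      ← Finset.mul_prod_erase S (fun k => ((Function.update a i (a i - 1) k)! : ℤ)) hi,
      Function.update_self, ← Nat.mul_factorial_pred (h0 i hi)]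
    have hE : ∏ k ∈ S.erase i, ((Function.update a i (a i - 1) k)! : ℤ) =
        ∏ k ∈ S.erase i, ((a k)! : ℤ) := Finset.prod_congr rfl fun k hk => by
      rw [Function.update_of_ne (Finset.ne_of_mem_erase hk)]
    rw [hE]
    push_cast
    ring
  rw [Finset.sum_congr rfl hterm, ← Finset.sum_mul]
  obtain ⟨i, hi⟩ := hS
  have hpos : ∑ k ∈ S, a k ≠ 0 := by rw [hsum i hi]; omega
  rw [← Nat.mul_factorial_pred hpos]
  push_cast
  rfl

end Dyson

section Vandermonde

/-- The Vandermonde product `∏_{i < j} (x_j - x_i)`. -/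
noncomputable def vandermondeProd (N : ℕ) : MvPolynomial (Fin N) ℤ :=
  ∏ i : Fin N, ∏ j ∈ Finset.Ioi i, (X j - X i)

variable {N : ℕ}

theorem vandermondeProd_eq_det :
    vandermondeProd N = (Matrix.vandermonde (X : Fin N → MvPolynomial (Fin N) ℤ)).det :=
  (Matrix.det_vandermonde _).symm

theorem vandermondeProd_eq_sum : vandermondeProd N =
    ∑ e : Equiv.Perm (Fin N), C (Equiv.Perm.sign e : ℤ) * ∏ i, X (e i) ^ (i : ℕ) := by
  rw [vandermondeProd_eq_det, Matrix.det_apply']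
  simp [Matrix.vandermonde_apply]

theorem rename_vandermondeProd (e : Equiv.Perm (Fin N)) :
    rename e (vandermondeProd N) = C (Equiv.Perm.sign e : ℤ) * vandermondeProd N := by
  have h := Matrix.det_permute e (Matrix.vandermonde (X : Fin N → MvPolynomial (Fin N) ℤ))
  rw [vandermondeProd_eq_det, AlgHom.map_det]
  convert h using 2
  · ext1 i j
    simp [Matrix.vandermonde_apply]
  · simp

theorem C_sign_mul_self {σ : Type*} (e : Equiv.Perm (Fin N)) :
    (C (Equiv.Perm.sign e : ℤ) * C (Equiv.Perm.sign e : ℤ) : MvPolynomial σ ℤ) = 1 := by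
  rw [← C_mul, ← Units.val_mul, Int.units_mul_self, Units.val_one, C_1]

theorem rename_vandermondeProd_pow_three (e : Equiv.Perm (Fin N)) :
    rename e (vandermondeProd N ^ 3) = C (Equiv.Perm.sign e : ℤ) * vandermondeProd N ^ 3 := by
  rw [map_pow, rename_vandermondeProd]
  linear_combination (C (Equiv.Perm.sign e : ℤ) * vandermondeProd N ^ 3) *
    C_sign_mul_self (σ := Fin N) e

theorem rename_vandermondeProd_pow_four (e : Equiv.Perm (Fin N)) :
    rename e (vandermondeProd N ^ 4) = vandermondeProd N ^ 4 := by
  rw [map_pow, rename_vandermondeProd]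
  linear_combination (vandermondeProd N ^ 4 *
    (C (Equiv.Perm.sign e : ℤ) * C (Equiv.Perm.sign e : ℤ) + 1)) * C_sign_mul_self (σ := Fin N) e

theorem funCoeff_comp_swap (f : Fin N → ℕ) {p q : Fin N} (hpq : p ≠ q) :
    funCoeff (f ∘ Equiv.swap p q) (vandermondeProd N ^ 3) =
      -funCoeff f (vandermondeProd N ^ 3) := by
  rw [← funCoeff_rename, rename_vandermondeProd_pow_three, funCoeff_C_mul,
    Equiv.Perm.sign_swap hpq]
  simp

theorem funCoeff_vandermondeProd_pow_three_eq_zero {f : Fin N → ℕ} {p q : Fin N} (hpq : p ≠ q)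
    (hf : f p = f q) : funCoeff f (vandermondeProd N ^ 3) = 0 := by
  have h := funCoeff_comp_swap f hpq
  have hs : f ∘ Equiv.swap p q = f := by
    ext k
    by_cases hkp : k = p
    · subst hkp; simp [hf]
    · by_cases hkq : k = q
      · subst hkq; simp [hf]
      · simp [Equiv.swap_apply_of_ne_of_ne hkp hkq]
  rw [hs] at h
  omega

theorem funCoeff_vandermondeProd_pow_four (f : Fin N → ℕ) :
    funCoeff f (vandermondeProd N ^ 4) = ∑ e : Equiv.Perm (Fin N),
      funCoeff (f ∘ e) ((∏ i : Fin N, X i ^ (i : ℕ)) * vandermondeProd N ^ 3) := by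
  conv_lhs => rw [pow_succ', vandermondeProd_eq_sum, Finset.sum_mul, map_sum,
    ← vandermondeProd_eq_sum]
  refine Finset.sum_congr rfl fun e _ => ?_
  rw [← funCoeff_rename, map_mul (rename e), rename_vandermondeProd_pow_three]
  congr 1
  simp only [map_prod, map_pow, rename_X]
  ring

theorem vandermondeProd_pow_four :
    vandermondeProd N ^ 4 = dysonProd Finset.univ fun _ => 2 := by
  have h1 : ∀ i : Fin N, ∏ j ∈ Finset.univ.erase i, (X j - X i : MvPolynomial (Fin N) ℤ) =
      (∏ j ∈ Finset.Ioi i, (X j - X i)) * ∏ j ∈ Finset.Iio i, (X j - X i) := by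
    intro i
    rw [← Finset.prod_union]
    · refine Finset.prod_congr ?_ fun _ _ => rfl
      ext j
      simp [lt_or_lt_iff_ne, eq_comm]
    · rw [Finset.disjoint_left]
      intro j hj hj'
      simp only [Finset.mem_Ioi, Finset.mem_Iio] at hj hj'
      exact lt_asymm hj hj'
  have h2 : ∏ i : Fin N, (∏ j ∈ Finset.Iio i, (X j - X i : MvPolynomial (Fin N) ℤ)) ^ 2 =
      vandermondeProd N ^ 2 := by
    rw [vandermondeProd, ← Finset.prod_pow]
    simp only [← Finset.prod_pow]
    rw [Finset.prod_comm' (t' := Finset.univ) (s' := fun j => Finset.Ioi j) (by simp)]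
    refine Finset.prod_congr rfl fun i _ => Finset.prod_congr rfl fun j _ => ?_
    ring
  simp only [dysonProd, h1, mul_pow, Finset.prod_mul_distrib, h2]
  rw [Finset.prod_pow, ← vandermondeProd]
  ring

open Nat in
theorem funCoeff_const_vandermondeProd_pow_four :
    funCoeff (fun _ => 2 * (N - 1)) (vandermondeProd N ^ 4) * 2 ^ N = ((2 * N)! : ℕ) := by
  have h := funCoeff_dysonProd (Finset.univ : Finset (Fin N)) fun _ => 2
  rw [← vandermondeProd_pow_four] at h
  simpa [Finset.card_erase_of_mem, mul_comm] using h

theorem pderiv_prod_X_sub_X {σ : Type*} [DecidableEq σ] (p : σ) (T : Finset σ) (hp : p ∉ T) :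
    pderiv p (∏ j ∈ T, (X p - X j) : MvPolynomial σ ℤ) =
      ∑ j ∈ T, ∏ k ∈ T.erase j, (X p - X k) := by
  induction T using Finset.induction_on with
  | empty => simp
  | insert i T hi ih =>
    have hip : i ≠ p := fun h => hp (by simp [h])
    rw [Finset.prod_insert hi, pderiv_mul, ih fun h => hp (Finset.mem_insert_of_mem h),
      Finset.sum_insert hi, Finset.erase_insert hi, map_sub, pderiv_X_self,
      pderiv_X_of_ne hip, sub_zero, one_mul, Finset.mul_sum]
    congr 1
    refine Finset.sum_congr rfl fun j hj => ?_
    have hij : i ≠ j := by rintro rfl; exact hi hj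
    rw [Finset.erase_insert_of_ne hij, Finset.prod_insert (by simp [hi])]

theorem exists_pderiv_vandermondeProd_pow_four (p : Fin N) :
    ∃ Q : Fin N → MvPolynomial (Fin N) ℤ,
      (∀ j, j ≠ p → (X p - X j) * Q j = vandermondeProd N ^ 4) ∧
      pderiv p (vandermondeProd N ^ 4) = C 4 * ∑ j ∈ Finset.univ.erase p, Q j := by
  have hp : p ∉ Finset.univ.erase p := Finset.notMem_erase _ _
  have hR := dysonProd_mem_supported (Finset.univ.erase p) (fun _ => 2) hp
  have hins := dysonProd_insert (Finset.univ.erase p) (fun _ => 2) hp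
  rw [Finset.insert_erase (Finset.mem_univ p), ← vandermondeProd_pow_four] at hins
  have hA := pderiv_prod_X_sub_X p (Finset.univ.erase p) hp
  have hdR : pderiv p (dysonProd (Finset.univ.erase p) fun _ => 2) = 0 :=
    pderiv_eq_zero_of_notMem_vars fun h => by simpa using (mem_supported.1 hR) h
  generalize dysonProd (Finset.univ.erase p) (fun _ => 2) = R at *
  have hneg : (∏ j ∈ Finset.univ.erase p, (X j - X p : MvPolynomial (Fin N) ℤ)) ^ 2 =
      (∏ j ∈ Finset.univ.erase p, (X p - X j)) ^ 2 := by
    rw [← Finset.prod_pow, ← Finset.prod_pow]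
    exact Finset.prod_congr rfl fun j _ => by ring
  rw [hneg, Finset.prod_pow] at hins
  refine ⟨fun j => (∏ k ∈ Finset.univ.erase p, (X p - X k)) ^ 3 *
    (∏ k ∈ (Finset.univ.erase p).erase j, (X p - X k)) * R, fun j hj => ?_, ?_⟩
  · have hj := Finset.mul_prod_erase (Finset.univ.erase p)
      (fun k => (X p - X k : MvPolynomial (Fin N) ℤ)) (a := j) (by simp [hj])
    rw [hins]
    linear_combination (∏ k ∈ Finset.univ.erase p, (X p - X k)) ^ 3 * R * hj
  · rw [← Finset.sum_mul, ← Finset.mul_sum, ← hA, hins, ← mul_assoc, ← pow_add, pderiv_mul, hdR,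
      pderiv_pow]
    simp
    ring

theorem rename_swap_eq_neg {P Q : MvPolynomial (Fin N) ℤ} {p j : Fin N} (hj : j ≠ p)
    (hP : rename (Equiv.swap p j) P = P) (hQ : (X p - X j) * Q = P) :
    rename (Equiv.swap p j) Q = -Q := by
  have h := congrArg (rename (Equiv.swap p j)) hQ
  rw [hP, map_mul, map_sub, rename_X, rename_X, Equiv.swap_apply_left, Equiv.swap_apply_right,
    ← hQ] at h
  have hne : (X p - X j : MvPolynomial (Fin N) ℤ) ≠ 0 :=
    sub_ne_zero.2 fun h => hj (X_injective h).symm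
  apply mul_left_cancel₀ hne
  linear_combination -h

theorem funCoeff_add_single_sub_single {d : ℕ} (hd : 0 < d) {p q : Fin N} (hpq : q ≠ p) :
    (d + 1) * funCoeff ((fun _ => d) - Pi.single q 1 + Pi.single p 1) (vandermondeProd N ^ 4) =
      -2 * funCoeff (fun _ => d) (vandermondeProd N ^ 4) := by
  obtain ⟨Q, hQ, hder⟩ := exists_pderiv_vandermondeProd_pow_four p
  have hanti : ∀ j, j ≠ p → rename (Equiv.swap p j) (Q j) = -Q j := fun j hj =>
    rename_swap_eq_neg hj (rename_vandermondeProd_pow_four _) (hQ j hj)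
  have h := congrArg (funCoeff ((fun _ => d) - Pi.single q 1)) hder
  rw [funCoeff_pderiv, funCoeff_C_mul, map_sum, Finset.sum_eq_single q] at h
  · have h1 := congrArg (funCoeff ((fun _ => d) - Pi.single q 1)) (hanti q hpq)
    have h2 : ((fun _ => d) - Pi.single q 1 : Fin N → ℕ) ∘ Equiv.swap p q =
        (fun _ => d) - Pi.single p 1 := by
      ext k
      simp only [Function.comp_apply, Pi.sub_apply, Pi.single_apply, Equiv.swap_apply_eq_iff,
        Equiv.swap_apply_right]
    have h3 := congrArg (funCoeff fun _ => d) (hQ q hpq)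
    rw [funCoeff_rename, h2, map_neg] at h1
    rw [_root_.sub_mul, map_sub, funCoeff_X_mul, funCoeff_X_mul, if_neg hd.ne', if_neg hd.ne', h1]
      at h3
    have h4 : ((fun _ => d) - Pi.single q 1 : Fin N → ℕ) p = d := by simp [hpq.symm]
    rw [h4] at h
    linear_combination h - 2 * h3
  · intro j hj hjq
    have hj := Finset.ne_of_mem_erase hj
    have h1 := congrArg (funCoeff ((fun _ => d) - Pi.single q 1)) (hanti j hj)
    have h2 : ((fun _ => d) - Pi.single q 1 : Fin N → ℕ) ∘ Equiv.swap p j =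
        (fun _ => d) - Pi.single q 1 := by
      ext k
      simp only [Function.comp_apply, Pi.sub_apply, Pi.single_apply, Equiv.swap_apply_eq_iff,
        Equiv.swap_apply_of_ne_of_ne hpq hjq.symm]
    rw [funCoeff_rename, h2, map_neg] at h1
    omega
  · simp [hpq]

theorem funCoeff_const_vandermondeProd_pow_four_eq :
    funCoeff (fun _ => 2 * (N - 1)) (vandermondeProd N ^ 4) =
      (N.factorial : ℤ) *
        funCoeff (fun i : Fin N => 2 * (N - 1) - (i : ℕ)) (vandermondeProd N ^ 3) := by
  have h : (fun _ => 2 * (N - 1) : Fin N → ℕ) =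
      (fun i : Fin N => 2 * (N - 1) - (i : ℕ)) + fun i : Fin N => (i : ℕ) := by
    ext i
    simp only [Pi.add_apply]
    omega
  rw [funCoeff_vandermondeProd_pow_four]
  simp only [Function.comp_def]
  rw [h, funCoeff_monomial_mul]
  simp [Fintype.card_perm]

theorem sum_funCoeff_vandermondeProd_pow_four (n : ℕ) (hn : 1 ≤ n) :
    ∑ p : Fin (n + 1), ∑ q : Fin (n + 1), (if q = p then 0 else
      funCoeff ((fun _ => 2 * n) - Pi.single q 1 + Pi.single p 1)
        (vandermondeProd (n + 1) ^ 4)) =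
    ((n + 1).factorial : ℤ) * ∑ p : Fin (n + 1), ∑ q : Fin (n + 1), if q = p then 0 else
      funCoeff ((fun i : Fin (n + 1) => 2 * n - (i : ℕ)) - Pi.single q 1 + Pi.single p 1)
        (vandermondeProd (n + 1) ^ 3) := by
  have hmon : ∀ p q : Fin (n + 1), ((fun _ => 2 * n) - Pi.single q 1 + Pi.single p 1) =
      ((fun i : Fin (n + 1) => 2 * n - (i : ℕ)) - Pi.single q 1 + Pi.single p 1) +
        fun i : Fin (n + 1) => (i : ℕ) := by
    intro p q
    ext i
    simp only [Pi.add_apply, Pi.sub_apply, Pi.single_apply]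
    split_ifs <;> omega
  have hcomp : ∀ (e : Equiv.Perm (Fin (n + 1))) (p q : Fin (n + 1)),
      ((fun _ => 2 * n) - Pi.single q 1 + Pi.single p 1 : Fin (n + 1) → ℕ) ∘ e =
        (fun _ => 2 * n) - Pi.single (e.symm q) 1 + Pi.single (e.symm p) 1 := by
    intro e p q
    ext k
    simp [Pi.single_apply, Equiv.eq_symm_apply]
  let F : Fin (n + 1) → Fin (n + 1) → ℤ := fun p q => if q = p then 0 else
      funCoeff ((fun i : Fin (n + 1) => 2 * n - (i : ℕ)) - Pi.single q 1 + Pi.single p 1)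
        (vandermondeProd (n + 1) ^ 3)
  have hF : ∀ p q, (if q = p then 0 else
      funCoeff ((fun _ => 2 * n) - Pi.single q 1 + Pi.single p 1)
        (vandermondeProd (n + 1) ^ 4)) =
      ∑ e : Equiv.Perm (Fin (n + 1)), F (e.symm p) (e.symm q) := by
    intro p q
    by_cases hpq : q = p
    · simp [F, hpq]
    · simp only [F, hpq, if_false, EmbeddingLike.apply_eq_iff_eq]
      rw [funCoeff_vandermondeProd_pow_four]
      refine Finset.sum_congr rfl fun e _ => ?_
      rw [hcomp, hmon, funCoeff_monomial_mul]
  simp only [hF]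
  have hswap : ∑ p, ∑ q, ∑ e : Equiv.Perm (Fin (n + 1)), F (e.symm p) (e.symm q) =
      ∑ e : Equiv.Perm (Fin (n + 1)), ∑ p, ∑ q, F (e.symm p) (e.symm q) := by
    rw [Finset.sum_comm]
    simp only [Finset.sum_comm (s := (Finset.univ : Finset (Fin (n + 1))))
      (t := (Finset.univ : Finset (Equiv.Perm (Fin (n + 1)))))]
    exact Finset.sum_congr rfl fun e _ => Finset.sum_comm
  rw [hswap]
  have he : ∀ e : Equiv.Perm (Fin (n + 1)), ∑ p, ∑ q, F (e.symm p) (e.symm q) =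
      ∑ p, ∑ q, F p q := by
    intro e
    rw [Equiv.sum_comp e.symm (fun p => ∑ q, F p (e.symm q))]
    exact Finset.sum_congr rfl fun p _ => Equiv.sum_comp e.symm (F p)
  simp only [he, F]
  simp [Fintype.card_perm]

theorem sum_funCoeff_vandermondeProd_pow_three (n : ℕ) (hn : 1 ≤ n) :
    (∑ p : Fin (n + 1), ∑ q : Fin (n + 1), if q = p then 0 else
      funCoeff ((fun i : Fin (n + 1) => 2 * n - (i : ℕ)) - Pi.single q 1 + Pi.single p 1)
        (vandermondeProd (n + 1) ^ 3)) =
    funCoeff ((fun i : Fin (n + 1) => 2 * n - (i : ℕ)) - Pi.single (Fin.last n) 1 +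
        Pi.single 0 1) (vandermondeProd (n + 1) ^ 3) -
      n * funCoeff (fun i : Fin (n + 1) => 2 * n - (i : ℕ)) (vandermondeProd (n + 1) ^ 3) := by
  have hzero : ∑ q : Fin (n + 1), (if q = 0 then 0 else
      funCoeff ((fun i : Fin (n + 1) => 2 * n - (i : ℕ)) - Pi.single q 1 + Pi.single 0 1)
        (vandermondeProd (n + 1) ^ 3)) =
      funCoeff ((fun i : Fin (n + 1) => 2 * n - (i : ℕ)) - Pi.single (Fin.last n) 1 +
        Pi.single 0 1) (vandermondeProd (n + 1) ^ 3) := by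
    rw [Finset.sum_eq_single (Fin.last n)]
    · rw [if_neg (by rw [Fin.ext_iff]; simp; omega)]
    · intro q _ hq
      have hqn : (q : ℕ) < n := Fin.val_lt_last hq
      split_ifs with hq0
      · rfl
      · have hq0' : (q : ℕ) ≠ 0 := fun h => hq0 (Fin.ext h)
        refine funCoeff_vandermondeProd_pow_three_eq_zero (p := q) (q := ⟨q + 1, by omega⟩)
          (by simp [Fin.ext_iff]) ?_
        simp [Fin.ext_iff, hq0']
        omega
    · simp
  have hsucc : ∀ k : Fin n, ∑ q : Fin (n + 1), (if q = k.succ then 0 else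
      funCoeff ((fun i : Fin (n + 1) => 2 * n - (i : ℕ)) - Pi.single q 1 + Pi.single k.succ 1)
        (vandermondeProd (n + 1) ^ 3)) =
      -funCoeff (fun i : Fin (n + 1) => 2 * n - (i : ℕ)) (vandermondeProd (n + 1) ^ 3) := by
    intro k
    have hk := k.2
    have hne : k.castSucc ≠ k.succ := by simp [Fin.ext_iff]
    rw [Finset.sum_eq_single k.castSucc]
    · rw [if_neg hne, ← funCoeff_comp_swap _ hne]
      congr 2
      ext i
      by_cases h1 : i = k.castSucc
      · subst h1
        simp [hne]
        omega
      · by_cases h2 : i = k.succ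
        · subst h2
          simp [hne.symm]
          omega
        · simp [Equiv.swap_apply_of_ne_of_ne h1 h2, h1, h2]
    · intro q _ hq
      split_ifs with hqk
      · rfl
      · refine funCoeff_vandermondeProd_pow_three_eq_zero hne ?_
        simp [hne, Ne.symm hq, Ne.symm hqk]
        omega
    · simp
  rw [Fin.sum_univ_succ, hzero, Finset.sum_congr rfl fun k _ => hsucc k]
  simp
  ring

/-- The sign relating the two orientations of the Vandermonde product. -/
def vandermondeSign (N : ℕ) : ℤ := ∏ i : Fin N, ∏ _j ∈ Finset.Ioi i, (-1)

theorem vandermondeSign_succ (n : ℕ) :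
    vandermondeSign (n + 1) = (-1) ^ n * vandermondeSign n := by
  simp only [vandermondeSign, Finset.prod_const, Fin.card_Ioi]
  rw [Fin.prod_univ_succ]
  congr 1
  refine Finset.prod_congr rfl fun i _ => ?_
  congr 1
  simp
  omega

theorem vandermondePoly_eq (N : ℕ) :
    vandermondePoly N = C (vandermondeSign N) * vandermondeProd N := by
  rw [vandermondePoly, Finset.prod_filter, ← Finset.univ_product_univ, Finset.prod_product,
    vandermondeSign, vandermondeProd, map_prod, ← Finset.prod_mul_distrib]
  refine Finset.prod_congr rfl fun i _ => ?_
  rw [map_prod, ← Finset.prod_mul_distrib, ← Finset.prod_filter]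
  refine Finset.prod_congr (by ext; simp) fun j _ => ?_
  simp

theorem schurCoeff_one (N : ℕ) (lam : Fin N → ℕ) :
    schurCoeff N 1 lam = vandermondeSign N ^ 3 *
      funCoeff (fun i : Fin N => lam i + (N - 1 - (i : ℕ))) (vandermondeProd N ^ 3) := by
  rw [schurCoeff, vandermondePoly_eq, mul_pow, ← C_pow, ← funCoeff_C_mul, funCoeff_apply]

end Vandermonde

/-- for `λ = ((n-1)^n)` and `μ = (n+1, n^{n-1}, n-1)`,
`⟨a_{δ_{n+1}}^2, s_μ⟩ = (-1)^{n-1} n ⟨a_{δ_n}^2, s_λ⟩`. -/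
theorem stmt_13 (n : ℕ) (hn : 1 ≤ n) :
    schurCoeff (n + 1) 1
        (fun j : Fin (n + 1) =>
          if (j : ℕ) = 0 then n + 1
          else if (j : ℕ) = n then n - 1
          else n) =
      (-1 : ℤ) ^ (n - 1) * (n : ℤ) * schurCoeff n 1 (fun _ : Fin n => n - 1) := by
  have hd := funCoeff_const_vandermondeProd_pow_four_eq (N := n)
  have hd' := funCoeff_const_vandermondeProd_pow_four_eq (N := n + 1)
  have hD := funCoeff_const_vandermondeProd_pow_four (N := n)
  have hD' := funCoeff_const_vandermondeProd_pow_four (N := n + 1)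
  have hsum := sum_funCoeff_vandermondeProd_pow_four n hn
  rw [sum_funCoeff_vandermondeProd_pow_three n hn] at hsum
  rw [hd] at hD
  rw [hd'] at hD'
  simp only [Nat.add_sub_cancel] at hd' hD'
  have hpair : (2 * n + 1 : ℤ) * ∑ p : Fin (n + 1), ∑ q : Fin (n + 1), (if q = p then 0 else
      funCoeff ((fun _ => 2 * n) - Pi.single q 1 + Pi.single p 1)
        (vandermondeProd (n + 1) ^ 4)) =
      (n + 1) * n * (-2 * funCoeff (fun _ => 2 * n) (vandermondeProd (n + 1) ^ 4)) := by
    have h1 : ∀ p q : Fin (n + 1), (2 * n + 1 : ℤ) * (if q = p then 0 else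
        funCoeff ((fun _ => 2 * n) - Pi.single q 1 + Pi.single p 1)
          (vandermondeProd (n + 1) ^ 4)) = if q = p then 0 else
        -2 * funCoeff (fun _ => 2 * n) (vandermondeProd (n + 1) ^ 4) := by
      intro p q
      split_ifs with h
      · simp
      · have := funCoeff_add_single_sub_single (d := 2 * n) (by omega) h
        push_cast at this
        exact this
    simp only [Finset.mul_sum, h1]
    simp [Finset.sum_ite, Finset.filter_ne']
    ring
  rw [hsum, hd'] at hpair
  have hf : ((n + 1).factorial : ℤ) ≠ 0 := by exact_mod_cast (n + 1).factorial_ne_zero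
  have hμ : (fun j : Fin (n + 1) => (if (j : ℕ) = 0 then n + 1 else if (j : ℕ) = n then n - 1
      else n) + (n + 1 - 1 - (j : ℕ))) =
      (fun i : Fin (n + 1) => 2 * n - (i : ℕ)) - Pi.single (Fin.last n) 1 + Pi.single 0 1 := by
    ext j
    simp only [Pi.add_apply, Pi.sub_apply, Pi.single_apply, Fin.ext_iff, Fin.val_last,
      Fin.val_zero]
    split_ifs <;> omega
  have hlam : (fun j : Fin n => n - 1 + (n - 1 - (j : ℕ))) =
      fun i : Fin n => 2 * (n - 1) - (i : ℕ) := by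
    ext j
    omega
  rw [schurCoeff_one, schurCoeff_one, hμ, hlam, vandermondeSign_succ]
  generalize funCoeff ((fun i : Fin (n + 1) => 2 * n - (i : ℕ)) - Pi.single (Fin.last n) 1 +
    Pi.single 0 1) (vandermondeProd (n + 1) ^ 3) = c at *
  generalize funCoeff (fun i : Fin (n + 1) => 2 * n - (i : ℕ)) (vandermondeProd (n + 1) ^ 3) = b'
    at *
  generalize funCoeff (fun i : Fin n => 2 * (n - 1) - (i : ℕ)) (vandermondeProd n ^ 3) = b at *
  have hc : (2 * n + 1 : ℤ) * c = -n * b' := by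
    apply mul_left_cancel₀ hf
    linear_combination hpair
  have hb : b' = (2 * n + 1) * b := by
    apply mul_left_cancel₀ (mul_ne_zero hf (pow_ne_zero (n + 1) (two_ne_zero (α := ℤ))))
    rw [show 2 * (n + 1) = 2 * n + 1 + 1 by ring, Nat.factorial_succ, Nat.factorial_succ] at hD'
    rw [Nat.factorial_succ] at hD' ⊢
    push_cast at hD' hD ⊢
    linear_combination hD' - (2 * n + 1) * (2 * n + 2) * hD
  have hcb : c = -n * b := by
    apply mul_left_cancel₀ (show (2 * n + 1 : ℤ) ≠ 0 by positivity)
    rw [hc, hb]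
    ring
  obtain ⟨m, rfl⟩ : ∃ m, n = m + 1 := ⟨n - 1, by omega⟩
  rw [hcb, Nat.add_sub_cancel, pow_succ (-1 : ℤ) m]
  rcases neg_one_pow_eq_or ℤ m with h | h <;> rw [h] <;> ring
end

section
/- Let n ≥ 1 and let λ = ((n−1)^n) be the partition of n(n−1) with n parts all equal to n−1 (the maximally bunched state). Then ⟨a_{δ_n}^2, s_λ⟩ = (−1)^{n(n−1)/2} · 1·3·5 ⋯ (2n−1). -/
open MvPolynomial Finset

/-- The `N`-th finite difference at `0` of the monomial `m ↦ m ^ k`, for `k ≤ N`. -/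
theorem sum_neg_one_pow_mul_choose_mul_pow {N k : ℕ} (hk : k ≤ N) :
    ∑ m ∈ range (N + 1), ((-1 : ℤ) ^ (N - m) * N.choose m) * (m : ℤ) ^ k =
      if k = N then (N.factorial : ℤ) else 0 := by
  have h := fwdDiff_iter_eq_sum_shift (1 : ℤ) (fun r : ℤ => r ^ k) N 0
  simp only [zero_add, nsmul_eq_mul, mul_one, smul_eq_mul] at h
  rw [← h]
  split_ifs with hkN
  · subst hkN
    rw [fwdDiff_iter_eq_factorial]
    simp
  · rw [fwdDiff_iter_pow_eq_zero_of_lt (lt_of_le_of_ne hk hkN)]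
    simp

/-- The coefficient form of the Combinatorial Nullstellensatz on the grid `{0, …, N}^σ`. -/
theorem sum_grid_eval_eq_factorial_mul_coeff {σ : Type*} [Fintype σ] [DecidableEq σ] (N : ℕ)
    (F : MvPolynomial σ ℤ) (hF : F.totalDegree ≤ Fintype.card σ * N) :
    ∑ x ∈ Fintype.piFinset (fun _ : σ => range (N + 1)),
        (∏ i, ((-1 : ℤ) ^ (N - x i) * N.choose (x i))) * eval (fun i => (x i : ℤ)) F =
      (N.factorial : ℤ) ^ Fintype.card σ *
        coeff (Finsupp.equivFunOnFinite.symm fun _ => N) F := by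
  set c : σ →₀ ℕ := Finsupp.equivFunOnFinite.symm fun _ => N with hc
  have hterm : ∀ d ∈ F.support,
      ∑ x ∈ Fintype.piFinset (fun _ : σ => range (N + 1)),
        (∏ i, ((-1 : ℤ) ^ (N - x i) * N.choose (x i))) * ∏ i, (x i : ℤ) ^ d i =
      if d = c then (N.factorial : ℤ) ^ Fintype.card σ else 0 := by
    intro d hd
    simp_rw [← prod_mul_distrib]
    rw [← prod_univ_sum (fun _ : σ => range (N + 1))
      (fun i m => ((-1 : ℤ) ^ (N - m) * N.choose m) * (m : ℤ) ^ d i)]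
    split_ifs with hdc
    · subst hdc
      simp [hc, sum_neg_one_pow_mul_choose_mul_pow]
    · have hdeg : ∑ i, d i ≤ ∑ _i : σ, N := by
        have := (le_totalDegree hd).trans hF
        rw [Finsupp.sum_fintype _ _ (fun _ => rfl)] at this
        simpa using this
      obtain ⟨i, hi⟩ : ∃ i, d i < N := by
        by_contra! hge
        refine hdc (Finsupp.ext fun i => ?_)
        have := (sum_eq_sum_iff_of_le (fun i _ => hge i)).1
          (le_antisymm (sum_le_sum fun i _ => hge i) hdeg) i (mem_univ i)
        simp [hc, ← this]
      refine prod_eq_zero (mem_univ i) ?_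
      rw [sum_neg_one_pow_mul_choose_mul_pow hi.le, if_neg hi.ne]
  simp_rw [eval_eq', mul_sum]
  rw [sum_comm]
  calc _ = ∑ d ∈ F.support, coeff d F *
        if d = c then (N.factorial : ℤ) ^ Fintype.card σ else 0 := by
        refine sum_congr rfl fun d hd => ?_
        rw [← hterm d hd, mul_sum]
        exact sum_congr rfl fun x _ => by ring
    _ = _ := by
        simp only [mul_ite, mul_zero, sum_ite_eq']
        split_ifs with h
        · ring
        · rw [notMem_support_iff.1 h, mul_zero]

/-- Lower-degree perturbations of homogeneous factors do not affect top-degree coefficients. -/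
theorem coeff_prod_add_eq_coeff_prod {ι σ R : Type*} [CommRing R] [DecidableEq ι] {s : Finset ι}
    {f g : ι → MvPolynomial σ R} {a b : ℕ} (hba : b < a) (hf : ∀ i ∈ s, (f i).IsHomogeneous a)
    (hg : ∀ i ∈ s, (g i).IsHomogeneous b) {d : σ →₀ ℕ} (hd : d.degree = #s * a) :
    coeff d (∏ i ∈ s, (f i + g i)) = coeff d (∏ i ∈ s, f i) := by
  rw [prod_add, coeff_sum, sum_eq_single_of_mem s (mem_powerset_self s)]
  · simp
  · intro t ht hts
    have hsub := mem_powerset.1 ht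
    refine IsHomogeneous.coeff_eq_zero
      ((IsHomogeneous.prod t f (fun _ => a) fun i hi => hf i (hsub hi)).mul
        (IsHomogeneous.prod (s \ t) g (fun _ => b) fun i hi => hg i (sdiff_subset hi))) ?_
    have hlt : 0 < #(s \ t) := card_pos.2 (sdiff_nonempty.2 fun h => hts (hsub.antisymm h))
    have := mul_lt_mul_of_pos_left hba hlt
    rw [hd, ← card_sdiff_add_card_eq_card hsub, add_mul]
    simp only [sum_const, smul_eq_mul]
    lia

/-- `n` points of `{0, …, 2n - 2}` with mutual distances at least `2` are `0, 2, …, 2n - 2`. -/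
theorem exists_perm_eq_two_mul {n : ℕ} {x : Fin n → ℕ} (hx : ∀ i, x i ≤ 2 * n - 2)
    (hsep : ∀ i j, i ≠ j → x i + 2 ≤ x j ∨ x j + 2 ≤ x i) :
    ∃ τ : Equiv.Perm (Fin n), ∀ i, x i = 2 * (τ i : ℕ) := by
  have hlo : ∀ i, x i / 2 < n := fun i => by have := hx i; have := i.isLt; lia
  have hhi : ∀ i, (x i + 1) / 2 < n := fun i => by have := hx i; have := i.isLt; lia
  have hlo_inj : Function.Injective fun i => (⟨x i / 2, hlo i⟩ : Fin n) := fun i j hij => by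
    by_contra hne
    have := hsep i j hne
    simp only [Fin.mk.injEq] at hij
    lia
  have hhi_inj : Function.Injective fun i => (⟨(x i + 1) / 2, hhi i⟩ : Fin n) := fun i j hij => by
    by_contra hne
    have := hsep i j hne
    simp only [Fin.mk.injEq] at hij
    lia
  have hsum : ∑ i, x i / 2 = ∑ i, (x i + 1) / 2 :=
    ((Equiv.ofBijective _ (Finite.injective_iff_bijective.1 hlo_inj)).sum_comp
      (fun j : Fin n => (j : ℕ))).trans
    ((Equiv.ofBijective _ (Finite.injective_iff_bijective.1 hhi_inj)).sum_comp
      (fun j : Fin n => (j : ℕ))).symm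
  have heq := (sum_eq_sum_iff_of_le (fun i _ => by lia)).1 hsum
  refine ⟨Equiv.ofBijective _ (Finite.injective_iff_bijective.1 hlo_inj), fun i => ?_⟩
  have := heq i (mem_univ i)
  simp only [Equiv.ofBijective_apply]
  lia

theorem sum_fin_val_eq_sum_fin_sub (n : ℕ) :
    ∑ i : Fin n, (i : ℕ) = ∑ i : Fin n, (n - 1 - (i : ℕ)) := by
  rw [← Equiv.sum_comp Fin.revPerm]
  exact sum_congr rfl fun i _ => by simp [Fin.val_rev]; lia

theorem card_filter_fst_lt_snd (n : ℕ) :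
    #(univ.filter fun p : Fin n × Fin n => p.1 < p.2) = ∑ i : Fin n, (n - 1 - (i : ℕ)) := by
  simp_rw [card_eq_sum_ones, sum_filter, Fintype.sum_prod_type, ← sum_filter, filter_lt_eq_Ioi,
    sum_const, Fin.card_Ioi, smul_eq_mul, mul_one]

theorem prod_filter_fst_lt_snd {M : Type*} [CommMonoid M] {n : ℕ} (f : Fin n → Fin n → M) :
    ∏ p ∈ univ.filter (fun p : Fin n × Fin n => p.1 < p.2), f p.1 p.2 =
      ∏ i, ∏ j ∈ Ioi i, f i j := by
  simp_rw [prod_filter, Fintype.prod_prod_type, ← prod_filter, filter_lt_eq_Ioi]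

theorem sum_fin_add_sub_eq_three_mul (n : ℕ) :
    ∑ i : Fin n, ((n - 1) + (n - 1 - (i : ℕ))) = (∑ i : Fin n, (n - 1 - (i : ℕ))) * 3 := by
  have h : ∑ i : Fin n, ((n - 1) + (n - 1 - (i : ℕ))) =
      ∑ i : Fin n, ((i : ℕ) + (n - 1 - (i : ℕ)) + (n - 1 - (i : ℕ))) :=
    sum_congr rfl fun i _ => by lia
  rw [h, sum_add_distrib, sum_add_distrib, sum_fin_val_eq_sum_fin_sub]
  lia

/-- The polynomial `∏_{i<j} (d³ - d) · ∏ xᵢ^i` with `d = xᵢ - xⱼ`. -/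
noncomputable def shiftedVandermonde (n : ℕ) : MvPolynomial (Fin n) ℤ :=
  (∏ p ∈ univ.filter (fun p : Fin n × Fin n => p.1 < p.2),
    ((X p.1 - X p.2) ^ 3 + -(X p.1 - X p.2))) *
      monomial (Finsupp.equivFunOnFinite.symm fun i : Fin n => (i : ℕ)) 1

theorem isHomogeneous_X_sub_X {σ R : Type*} [CommRing R] (i j : σ) :
    (X i - X j : MvPolynomial σ R).IsHomogeneous 1 :=
  (isHomogeneous_X R i).sub (isHomogeneous_X R j)

theorem schurCoeff_eq_coeff_shiftedVandermonde (n : ℕ) :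
    schurCoeff n 1 (fun _ : Fin n => n - 1) =
      coeff (Finsupp.equivFunOnFinite.symm fun _ : Fin n => 2 * n - 2) (shiftedVandermonde n) := by
  have hexp : (Finsupp.equivFunOnFinite.symm fun _ : Fin n => 2 * n - 2) =
      (Finsupp.equivFunOnFinite.symm fun i : Fin n => (n - 1) + (n - 1 - (i : ℕ))) +
        Finsupp.equivFunOnFinite.symm fun i : Fin n => (i : ℕ) := by
    ext i
    simp
    lia
  rw [hexp, shiftedVandermonde, coeff_mul_monomial, mul_one, schurCoeff, vandermondePoly,
    ← prod_pow]
  refine (coeff_prod_add_eq_coeff_prod (a := 3) (b := 1) (by norm_num)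
    (fun p _ => (isHomogeneous_X_sub_X _ _).pow 3) (fun p _ => (isHomogeneous_X_sub_X _ _).neg)
    ?_).symm
  rw [card_filter_fst_lt_snd, ← sum_fin_add_sub_eq_three_mul, Finsupp.degree_eq_sum]
  rfl

theorem totalDegree_shiftedVandermonde_le (n : ℕ) :
    (shiftedVandermonde n).totalDegree ≤ Fintype.card (Fin n) * (2 * n - 2) := by
  have hfactor : ∀ p : Fin n × Fin n, ((X p.1 - X p.2) ^ 3 + -(X p.1 - X p.2) :
      MvPolynomial (Fin n) ℤ).totalDegree ≤ 3 := fun p => by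
    refine (totalDegree_add _ _).trans (max_le ?_ ?_)
    · exact ((isHomogeneous_X_sub_X _ _).pow 3).totalDegree_le
    · exact (isHomogeneous_X_sub_X _ _).neg.totalDegree_le.trans (by norm_num)
  have hmon : (monomial (Finsupp.equivFunOnFinite.symm fun i : Fin n => (i : ℕ))
      (1 : ℤ)).totalDegree ≤ ∑ i : Fin n, (i : ℕ) := by
    refine (totalDegree_monomial_le _ _).trans_eq ?_
    rw [Finsupp.sum_fintype _ _ fun _ => rfl]
    rfl
  refine (totalDegree_mul _ _).trans ((add_le_add ((totalDegree_finsetProd _ _).trans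
    (sum_le_sum fun p _ => hfactor p)) hmon).trans_eq ?_)
  rw [sum_const, card_filter_fst_lt_snd, smul_eq_mul, ← sum_fin_add_sub_eq_three_mul,
    ← sum_add_distrib, ← smul_eq_mul, ← card_univ, ← sum_const]
  exact sum_congr rfl fun i _ => by lia

theorem eval_shiftedVandermonde {n : ℕ} (x : Fin n → ℤ) :
    eval x (shiftedVandermonde n) =
      (∏ i, ∏ j ∈ Ioi i, ((x i - x j) ^ 3 - (x i - x j))) * ∏ i : Fin n, x i ^ (i : ℕ) := by
  rw [shiftedVandermonde, map_mul, map_prod, eval_monomial, one_mul,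
    Finsupp.prod_fintype _ _ fun _ => pow_zero _]
  simp only [map_pow, map_sub, eval_X, ← sub_eq_add_neg]
  rw [prod_filter_fst_lt_snd fun i j => (x i - x j) ^ 3 - (x i - x j)]
  rfl

theorem exists_perm_of_eval_shiftedVandermonde_ne_zero {n : ℕ} {x : Fin n → ℕ}
    (hx : ∀ i, x i ≤ 2 * n - 2) (h : eval (fun i => (x i : ℤ)) (shiftedVandermonde n) ≠ 0) :
    ∃ τ : Equiv.Perm (Fin n), ∀ i, x i = 2 * (τ i : ℕ) := by
  rw [eval_shiftedVandermonde] at h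
  have hlt : ∀ i j : Fin n, i < j → x i + 2 ≤ x j ∨ x j + 2 ≤ x i := fun i j hij => by
    have hne := prod_ne_zero_iff.1 (prod_ne_zero_iff.1 (left_ne_zero_of_mul h) i (mem_univ i)) j
      (mem_Ioi.2 hij)
    by_contra! hclose
    have : (x i : ℤ) - x j = -1 ∨ (x i : ℤ) - x j = 0 ∨ (x i : ℤ) - x j = 1 := by lia
    rcases this with h | h | h <;> simp [h] at hne
  refine exists_perm_eq_two_mul hx fun i j hij => ?_
  rcases lt_or_gt_of_ne hij with hij | hij
  · exact hlt i j hij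
  · exact (hlt j i hij).symm

/-- Only the permutations of `(0, 2, …, 2n - 2)` contribute to the grid sum, which collapses to a
Vandermonde determinant. -/
theorem sum_grid_eval_shiftedVandermonde (n : ℕ) :
    ∑ x ∈ Fintype.piFinset (fun _ : Fin n => range (2 * n - 2 + 1)),
        (∏ i, ((-1 : ℤ) ^ (2 * n - 2 - x i) * (2 * n - 2).choose (x i))) *
          eval (fun i => (x i : ℤ)) (shiftedVandermonde n) =
      (∏ i : Fin n, ((2 * n - 2).choose (2 * i) : ℤ)) *
        ∏ i : Fin n, ∏ j ∈ Ioi i, (((2 * i - 2 * j : ℤ) ^ 3 - (2 * i - 2 * j)) *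
          (2 * j - 2 * i)) := by
  have hterm : ∀ τ : Equiv.Perm (Fin n),
      (∏ i, ((-1 : ℤ) ^ (2 * n - 2 - 2 * (τ i : ℕ)) * (2 * n - 2).choose (2 * τ i))) *
        eval (fun i => ((2 * (τ i : ℕ) : ℕ) : ℤ)) (shiftedVandermonde n) =
      (∏ i : Fin n, ((2 * n - 2).choose (2 * i) : ℤ)) *
        (∏ i : Fin n, ∏ j ∈ Ioi i, ((2 * i - 2 * j : ℤ) ^ 3 - (2 * i - 2 * j))) *
          (Equiv.Perm.sign τ * ∏ i : Fin n, (2 * (τ i : ℕ) : ℤ) ^ (i : ℕ)) := fun τ => by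
    have hsign : ∀ i : Fin n, (-1 : ℤ) ^ (2 * n - 2 - 2 * (i : ℕ)) = 1 := fun i =>
      Even.neg_one_pow ⟨n - 1 - i, by lia⟩
    simp only [hsign, one_mul]
    rw [Equiv.prod_comp τ fun i : Fin n => ((2 * n - 2).choose (2 * i) : ℤ),
      eval_shiftedVandermonde]
    push_cast
    rw [τ.prod_Ioi_comp_eq_sign_mul_prod
      (f := fun i j : Fin n => (2 * i - 2 * j : ℤ) ^ 3 - (2 * i - 2 * j)) (fun i j => by ring)]
    simp only [Int.cast_id]
    ring
  have hdet : ∑ τ : Equiv.Perm (Fin n),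
      ((Equiv.Perm.sign τ : ℤ) * ∏ i : Fin n, (2 * (τ i : ℕ) : ℤ) ^ (i : ℕ)) =
        ∏ i : Fin n, ∏ j ∈ Ioi i, (2 * j - 2 * i : ℤ) := by
    rw [← Matrix.det_vandermonde fun i : Fin n => (2 * (i : ℕ) : ℤ), Matrix.det_apply']
    simp [Matrix.vandermonde_apply]
  simp_rw [prod_mul_distrib]
  rw [← hdet, ← mul_assoc, mul_sum]
  simp_rw [← hterm]
  symm
  refine sum_of_injOn (fun τ i => 2 * (τ i : ℕ)) ?_ ?_ ?_ ?_
  · intro τ _ τ' _ h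
    ext i
    have := congrFun h i
    simpa using this
  · intro τ _
    refine mem_coe.2 (Fintype.mem_piFinset.2 fun i => mem_range.2 ?_)
    have := (τ i).isLt
    lia
  · intro x hx hnot
    rw [mul_eq_zero]
    right
    by_contra hne
    obtain ⟨τ, hτ⟩ := exists_perm_of_eval_shiftedVandermonde_ne_zero
      (fun i => by have := Fintype.mem_piFinset.1 hx i; simp at this; lia) hne
    exact hnot ⟨τ, by simp, funext fun i => (hτ i).symm⟩
  · intro τ _
    simp [prod_mul_distrib]

theorem prod_range_even_cube_sub_self_mul (n : ℕ) :
    ∏ t ∈ range n, (((2 * t + 2 : ℤ) ^ 3 - (2 * t + 2)) * (2 * t + 2)) =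
      ((2 * n).factorial : ℤ) * (2 * n + 1).factorial := by
  induction n with
  | zero => simp
  | succ n ih =>
    rw [prod_range_succ, ih, show 2 * (n + 1) = 2 * n + 1 + 1 by ring]
    simp only [Nat.factorial_succ]
    push_cast
    ring

theorem prod_two_mul_sub_cube_sub_self_mul (n : ℕ) :
    ∏ i : Fin n, ∏ j ∈ Ioi i, (((2 * i - 2 * j : ℤ) ^ 3 - (2 * i - 2 * j)) * (2 * j - 2 * i)) =
      (-1) ^ (n * (n - 1) / 2) *
        ∏ t ∈ range n, (((2 * t).factorial : ℤ) * (2 * t + 1).factorial) := by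
  induction n with
  | zero => simp
  | succ n ih =>
    have hrow : ∏ j : Fin n, (((0 - 2 * (j + 1) : ℤ) ^ 3 - (0 - 2 * (j + 1))) *
        (2 * (j + 1) - 0)) = (-1) ^ n * (((2 * n).factorial : ℤ) * (2 * n + 1).factorial) := by
      rw [Fin.prod_univ_eq_prod_range (fun j : ℕ => (((0 - 2 * (j + 1) : ℤ) ^ 3 -
        (0 - 2 * (j + 1))) * (2 * (j + 1) - 0))) n, ← prod_range_even_cube_sub_self_mul]
      nth_rw 2 [← card_range n]
      rw [← prod_const, ← prod_mul_distrib]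
      exact prod_congr rfl fun t _ => by ring
    have htri : (n + 1) * (n + 1 - 1) / 2 = n * (n - 1) / 2 + n := by
      rw [← sum_range_id, ← sum_range_id, sum_range_succ]
    rw [Fin.prod_univ_succ, Fin.prod_Ioi_zero, htri, prod_range_succ, pow_add]
    simp only [Fin.prod_Ioi_succ, Fin.val_zero, Fin.val_succ, Nat.cast_zero, mul_zero,
      Nat.cast_add, Nat.cast_one, hrow]
    have hshift : ∀ i j : Fin n, (2 * ((i : ℤ) + 1) - 2 * (j + 1)) = 2 * i - 2 * j :=
      fun i j => by ring
    simp only [hshift, ih]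
    ring

theorem prod_choose_two_mul (n : ℕ) :
    (∏ i : Fin n, ((2 * n - 2).choose (2 * i) : ℤ)) *
        ∏ t ∈ range n, (((2 * t).factorial : ℤ) * (2 * t).factorial) =
      ((2 * n - 2).factorial : ℤ) ^ n := by
  have hreflect := prod_range_reflect (fun t => ((2 * t).factorial : ℤ)) n
  rw [Fin.prod_univ_eq_prod_range (fun i => ((2 * n - 2).choose (2 * i) : ℤ)) n,
    prod_mul_distrib]
  nth_rw 2 [← hreflect]
  rw [← prod_mul_distrib, ← prod_mul_distrib, prod_eq_pow_card (b := ((2 * n - 2).factorial : ℤ)),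
    card_range]
  intro t ht
  have hle : 2 * t ≤ 2 * n - 2 := by have := mem_range.1 ht; lia
  rw [show 2 * (n - 1 - t) = 2 * n - 2 - 2 * t by lia, ← mul_assoc]
  exact_mod_cast Nat.choose_mul_factorial_mul_factorial hle

/-- for the maximally bunched state `λ = ((n-1)^n)`,
`⟨a_{δ_n}^2, s_λ⟩ = (-1)^{n(n-1)/2} · 1·3·5⋯(2n-1)`. -/
theorem stmt_14 (n : ℕ) (hn : 1 ≤ n) :
    schurCoeff n 1 (fun _ : Fin n => n - 1) =
      (-1 : ℤ) ^ (n * (n - 1) / 2) * ∏ t ∈ Finset.range n, (2 * (t : ℤ) + 1) := by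
  have h := sum_grid_eval_eq_factorial_mul_coeff (2 * n - 2) (shiftedVandermonde n)
    (totalDegree_shiftedVandermonde_le n)
  rw [sum_grid_eval_shiftedVandermonde, prod_two_mul_sub_cube_sub_self_mul,
    ← schurCoeff_eq_coeff_shiftedVandermonde, Fintype.card_fin] at h
  have hne : ((2 * n - 2).factorial : ℤ) ^ n ≠ 0 :=
    pow_ne_zero _ (Nat.cast_ne_zero.2 (Nat.factorial_ne_zero _))
  refine mul_left_cancel₀ hne ?_
  have hodd : ∏ t ∈ range n, (((2 * t).factorial : ℤ) * (2 * t + 1).factorial) =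
      (∏ t ∈ range n, (((2 * t).factorial : ℤ) * (2 * t).factorial)) *
        ∏ t ∈ range n, (2 * (t : ℤ) + 1) := by
    rw [← prod_mul_distrib]
    refine prod_congr rfl fun t _ => ?_
    rw [Nat.factorial_succ]
    push_cast
    ring
  rw [← h, hodd, ← prod_choose_two_mul]
  ring
end
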